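/- Let 1 < p < ∞. If 𝓜 is a nonzero prime ideal in the ring N^p which is not a dense subset of the metric space (N^p, d_p), then there exists λ in the open unit disk 𝔻 such that 𝓜 = {f ∈ N^p : f(λ) = 0}. -/

import Mathlib

open MeasureTheory Filter Set
open scoped ENNReal Topology Real NNReal

noncomputable section

/-- The open unit disk in the complex plane. -/
def unitDisk : Set ℂ := Metric.ball 0 1

/-- The point `r·e^{iθ}`. -/
def circlePt (r θ : ℝ) : ℂ := (r : ℂ) * Complex.exp (θ * Complex.I)

/-- The maximal radial function `Mf(θ) = sup_{0 ≤ r < 1} |f(r e^{iθ})|`, valued in `ℝ≥0∞`. -/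
def maxRad (f : ℂ → ℂ) (θ : ℝ) : ℝ≥0∞ :=
  ⨆ r ∈ Set.Ico (0 : ℝ) 1, (‖f (circlePt r θ)‖₊ : ℝ≥0∞)

/-- `log⁺` on `ℝ≥0∞`. -/
def elogPlus (x : ℝ≥0∞) : ℝ≥0∞ :=
  if x = ∞ then ∞ else ENNReal.ofReal (Real.log x.toReal)

/-- `x ↦ log (1 + x)` on `ℝ≥0∞`. -/
def elog1p (x : ℝ≥0∞) : ℝ≥0∞ :=
  if x = ∞ then ∞ else ENNReal.ofReal (Real.log (1 + x.toReal))

/-- The radial boundary value `f*(e^{iθ}) = lim_{r→1⁻} f(r e^{iθ})`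
(a junk value is returned where the limit does not exist). -/
def radialLimit (f : ℂ → ℂ) (θ : ℝ) : ℂ :=
  limUnder (nhdsWithin (1 : ℝ) (Set.Iio 1)) fun r : ℝ => f (circlePt r θ)

/-- The class `M^p`: holomorphic functions on the unit disk with
`∫₀^{2π} (log⁺ Mf(θ))^p dθ/2π < ∞`. -/
def MpClass (p : ℝ) : Set (ℂ → ℂ) :=
  {f | DifferentiableOn ℂ f unitDisk ∧
    (∫⁻ θ in Set.Ioc 0 (2 * π), elogPlus (maxRad f θ) ^ p) / ENNReal.ofReal (2 * π) < ∞}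

/-- The metric `ρ_p` on `M^p`. -/
def rhoMetric (p : ℝ) (f g : ℂ → ℂ) : ℝ≥0∞ :=
  ((∫⁻ θ in Set.Ioc 0 (2 * π), elog1p (maxRad (f - g) θ) ^ p) /
    ENNReal.ofReal (2 * π)) ^ (1 / p)

/-- The Privalov class `N^p`: holomorphic functions on the unit disk with
`sup_{0≤r<1} ∫₀^{2π} (log⁺|f(re^{iθ})|)^p dθ/2π < ∞`. -/
def NpClass (p : ℝ) : Set (ℂ → ℂ) :=
  {f | DifferentiableOn ℂ f unitDisk ∧
    (⨆ r ∈ Set.Ico (0 : ℝ) 1,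
      (∫⁻ θ in Set.Ioc 0 (2 * π),
        ENNReal.ofReal (Real.log ‖f (circlePt r θ)‖) ^ p) / ENNReal.ofReal (2 * π)) < ∞}

/-- The metric `d_p` on `N^p`, defined via boundary values. -/
def dMetric (p : ℝ) (f g : ℂ → ℂ) : ℝ≥0∞ :=
  ((∫⁻ θ in Set.Ioc 0 (2 * π),
      ENNReal.ofReal (Real.log (1 + ‖radialLimit f θ - radialLimit g θ‖)) ^ p) /
    ENNReal.ofReal (2 * π)) ^ (1 / p)

/-- The Hardy space `H^p`. -/
def HpClass (p : ℝ) : Set (ℂ → ℂ) :=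
  {f | DifferentiableOn ℂ f unitDisk ∧
    (⨆ r ∈ Set.Ico (0 : ℝ) 1,
      (∫⁻ θ in Set.Ioc 0 (2 * π), (‖f (circlePt r θ)‖₊ : ℝ≥0∞) ^ p) /
        ENNReal.ofReal (2 * π)) < ∞}

/-- The Smirnov class `N⁺`. -/
def SmirnovClass : Set (ℂ → ℂ) :=
  {f | DifferentiableOn ℂ f unitDisk ∧
    (∫⁻ θ in Set.Ioc 0 (2 * π), ENNReal.ofReal (Real.log ‖radialLimit f θ‖)) /
      ENNReal.ofReal (2 * π) < ∞ ∧
    Tendsto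
      (fun r : ℝ => (∫⁻ θ in Set.Ioc 0 (2 * π),
        ENNReal.ofReal (Real.log ‖f (circlePt r θ)‖)) / ENNReal.ofReal (2 * π))
      (nhdsWithin (1 : ℝ) (Set.Iio 1))
      (nhds ((∫⁻ θ in Set.Ioc 0 (2 * π),
        ENNReal.ofReal (Real.log ‖radialLimit f θ‖)) / ENNReal.ofReal (2 * π)))}

/-- The normalized Blaschke factor `(|a|/a)·(a − z)/(1 − conj a · z)`. -/
def blaschkeFactor (a z : ℂ) : ℂ :=
  ((‖a‖ : ℂ) / a) * ((a - z) / (1 - (starRingEnd ℂ) a * z))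

/-- `B` is a (finite or infinite) Blaschke product on the unit disk. -/
def IsBlaschkeProduct (B : ℂ → ℂ) : Prop :=
  ∃ m : ℕ,
    (∃ n : ℕ, ∃ a : ℕ → ℂ, (∀ k < n, a k ∈ unitDisk ∧ a k ≠ 0) ∧
      ∀ z ∈ unitDisk, B z = z ^ m * ∏ k ∈ Finset.range n, blaschkeFactor (a k) z) ∨
    (∃ a : ℕ → ℂ, (∀ k, a k ∈ unitDisk ∧ a k ≠ 0) ∧ (Summable fun k => 1 - ‖a k‖) ∧
      ∀ z ∈ unitDisk, B z = z ^ m * ∏' k, blaschkeFactor (a k) z)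

/-- `I` is an ideal of the ring `M^p`. -/
structure IsIdealIn (p : ℝ) (I : Set (ℂ → ℂ)) : Prop where
  subset : I ⊆ MpClass p
  zero_mem : (0 : ℂ → ℂ) ∈ I
  add_mem : ∀ f ∈ I, ∀ g ∈ I, f + g ∈ I
  neg_mem : ∀ f ∈ I, -f ∈ I
  mul_mem : ∀ f ∈ MpClass p, ∀ g ∈ I, f * g ∈ I

/-- `I` is a prime ideal of the ring `M^p`: an ideal such that whenever a product of two
elements of `M^p` lies in `I`, one of the factors lies in `I`. -/
def IsPrimeIdealIn (p : ℝ) (I : Set (ℂ → ℂ)) : Prop :=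
  IsIdealIn p I ∧ ∀ f ∈ MpClass p, ∀ g ∈ MpClass p, f * g ∈ I → f ∈ I ∨ g ∈ I

/-- `I` is a dense subset of the metric space `(M^p, ρ_p)`. -/
def IsDenseIn (p : ℝ) (I : Set (ℂ → ℂ)) : Prop :=
  ∀ f ∈ MpClass p, ∀ ε : ℝ≥0∞, 0 < ε → ∃ g ∈ I, rhoMetric p f g < ε

/-- `I` is an ideal of the ring `N^p`. -/
structure IsIdealInNp (p : ℝ) (I : Set (ℂ → ℂ)) : Prop where
  subset : I ⊆ NpClass p
  zero_mem : (0 : ℂ → ℂ) ∈ I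
  add_mem : ∀ f ∈ I, ∀ g ∈ I, f + g ∈ I
  neg_mem : ∀ f ∈ I, -f ∈ I
  mul_mem : ∀ f ∈ NpClass p, ∀ g ∈ I, f * g ∈ I

/-- `I` is a prime ideal of the ring `N^p`. -/
def IsPrimeIdealInNp (p : ℝ) (I : Set (ℂ → ℂ)) : Prop :=
  IsIdealInNp p I ∧ ∀ f ∈ NpClass p, ∀ g ∈ NpClass p, f * g ∈ I → f ∈ I ∨ g ∈ I

/-- `I` is a dense subset of the metric space `(N^p, d_p)`. -/
def IsDenseInNp (p : ℝ) (I : Set (ℂ → ℂ)) : Prop :=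
  ∀ f ∈ NpClass p, ∀ ε : ℝ≥0∞, 0 < ε → ∃ g ∈ I, dMetric p f g < ε


/-- Holomorphic on the disk and bounded by one. -/
def SchurFn (f : ℂ → ℂ) : Prop :=
  DifferentiableOn ℂ f unitDisk ∧ ∀ z ∈ unitDisk, ‖f z‖ ≤ 1

lemma mem_unitDisk {z : ℂ} : z ∈ unitDisk ↔ ‖z‖ < 1 := by simp [unitDisk]

lemma isOpen_unitDisk : IsOpen unitDisk := Metric.isOpen_ball

lemma zero_mem_unitDisk : (0 : ℂ) ∈ unitDisk := by simp [mem_unitDisk]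

lemma schur_taylor {f : ℂ → ℂ} (hf : SchurFn f) {w z : ℂ}
    (hz : z ∈ Metric.ball w (1 - ‖w‖)) :
    ‖deriv f w‖ ≤ 2 / (1 - ‖w‖) ∧
    ‖f z - f w - (z - w) * deriv f w‖ ≤ 4 / (1 - ‖w‖) ^ 2 * ‖z - w‖ ^ 2 := by
  have hρ : 0 < 1 - ‖w‖ := lt_of_le_of_lt dist_nonneg (Metric.mem_ball.1 hz)
  have hsub : Metric.ball w (1 - ‖w‖) ⊆ unitDisk := by
    intro x hx
    rw [Metric.mem_ball, dist_eq_norm] at hx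
    rw [mem_unitDisk]
    have : ‖x‖ ≤ ‖x - w‖ + ‖w‖ := by simpa using norm_add_le (x - w) w
    linarith
  have hw : w ∈ unitDisk := hsub (Metric.mem_ball_self hρ)
  have hd := hf.1.mono hsub
  have h1 : ∀ x ∈ Metric.ball w (1 - ‖w‖), ‖f x - f w‖ ≤ 2 := fun x hx => by
    have := norm_sub_le (f x) (f w)
    have := hf.2 x (hsub hx)
    have := hf.2 w hw
    linarith
  have hder : ‖deriv f w‖ ≤ 2 / (1 - ‖w‖) := by
    apply Complex.norm_deriv_le_div_of_mapsTo_ball hd _ hρ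
    intro x hx
    rw [Metric.mem_closedBall, dist_eq_norm]
    exact h1 x hx
  refine ⟨hder, ?_⟩
  have hfd : HasDerivAt f (deriv f w) w :=
    (hf.1.differentiableAt (isOpen_unitDisk.mem_nhds hw)).hasDerivAt
  have key := Complex.dist_le_mul_div_pow_of_mapsTo_ball_of_isLittleO
    (f := fun x => f x - (x - w) * deriv f w) (c := w) (z := z) (R₁ := 1 - ‖w‖) (R₂ := 4) (n := 1)
    (hd.sub (by fun_prop)) ?_ ?_ hz
  · simp only [sub_self, zero_mul, sub_zero, dist_eq_norm] at key
    calc _ = ‖f z - (z - w) * deriv f w - f w‖ := by congr 1; ring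
      _ ≤ _ := key
      _ = _ := by simp only [Nat.reduceAdd, div_pow]; ring
  · intro x hx
    simp only [sub_self, zero_mul, sub_zero, Metric.mem_closedBall, dist_eq_norm]
    calc ‖f x - (x - w) * deriv f w - f w‖ = ‖(f x - f w) - (x - w) * deriv f w‖ := by congr 1; ring
      _ ≤ ‖f x - f w‖ + ‖x - w‖ * ‖deriv f w‖ := by
        rw [← norm_mul]; exact norm_sub_le _ _
      _ ≤ 2 + (1 - ‖w‖) * (2 / (1 - ‖w‖)) := by
        gcongr
        · exact h1 x hx
        · rw [Metric.mem_ball, dist_eq_norm] at hx; exact hx.le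
      _ = 4 := by field_simp; norm_num
  · have := hasDerivAt_iff_isLittleO.1 hfd
    simp only [sub_self, zero_mul, sub_zero]
    have h2 := this.norm_right
    refine (h2.congr_left ?_).congr_right ?_
    · intro x; simp only [smul_eq_mul]; ring
    · intro x; simp

/-- Normal families, in ultrafilter form. -/
lemma ultra_lim (v : ℕ → ℂ → ℂ) (hv : ∀ n, SchurFn (v n)) :
    ∃ V, SchurFn V ∧ ∀ z ∈ unitDisk,
      Tendsto (fun n => v n z) (hyperfilter ℕ : Filter ℕ) (𝓝 (V z)) := by
  have hcpt : ∀ (C : ℝ) (s : ℕ → ℂ), (∀ n, ‖s n‖ ≤ C) →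
      ∃ x, ‖x‖ ≤ C ∧ Tendsto s (hyperfilter ℕ : Filter ℕ) (𝓝 x) := by
    intro C s hs
    obtain ⟨x, hx, hle⟩ := (isCompact_closedBall (0 : ℂ) C).ultrafilter_le_nhds'
      ((hyperfilter ℕ).map s) (by
        rw [Ultrafilter.mem_map]
        exact Filter.univ_mem' (fun n => by simpa using hs n))
    exact ⟨x, by simpa using hx, hle⟩
  have h0 : ∀ z, ∃ x, z ∈ unitDisk →
      ‖x‖ ≤ 1 ∧ Tendsto (fun n => v n z) (hyperfilter ℕ : Filter ℕ) (𝓝 x) := by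
    intro z
    by_cases hz : z ∈ unitDisk
    · obtain ⟨x, hx⟩ := hcpt 1 (fun n => v n z) (fun n => (hv n).2 z hz)
      exact ⟨x, fun _ => hx⟩
    · exact ⟨0, fun h => absurd h hz⟩
  choose V hV using h0
  refine ⟨V, ⟨?_, fun z hz => (hV z hz).1⟩, fun z hz => (hV z hz).2⟩
  intro w hw
  have hρ : 0 < 1 - ‖w‖ := by rw [mem_unitDisk] at hw; linarith
  obtain ⟨d, -, hd⟩ := hcpt (2 / (1 - ‖w‖)) (fun n => deriv (v n) w)
    (fun n => (schur_taylor (hv n) (Metric.mem_ball_self hρ)).1)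
  have hda : HasDerivAt V d w := by
    rw [hasDerivAt_iff_isLittleO]
    have hO : (fun x => V x - V w - (x - w) • d) =O[𝓝 w] (fun x => ‖x - w‖ ^ 2) := by
      apply Asymptotics.IsBigO.of_bound (4 / (1 - ‖w‖) ^ 2)
      filter_upwards [Metric.ball_mem_nhds w hρ] with x hx
      have hxd : x ∈ unitDisk := by
        rw [Metric.mem_ball, dist_eq_norm] at hx
        rw [mem_unitDisk]
        have : ‖x‖ ≤ ‖x - w‖ + ‖w‖ := by simpa using norm_add_le (x - w) w
        linarith
      have ht := ((((hV x hxd).2.sub (hV w hw).2).sub (hd.const_mul (x - w)))).norm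
      have := le_of_tendsto ht (Eventually.of_forall fun n => (schur_taylor (hv n) hx).2)
      simpa using this
    refine hO.trans_isLittleO ?_
    have h3 : (fun x : ℂ => ‖x - w‖ ^ 2) =o[𝓝 w] fun x => ‖x - w‖ ^ 1 := by
      have h4 : (fun x : ℂ => x ^ 2) =o[𝓝 0] fun x => x ^ 1 :=
        Asymptotics.isLittleO_pow_pow one_lt_two
      have h5 : Tendsto (fun x : ℂ => x - w) (𝓝 w) (𝓝 0) := by
        have : Continuous (fun x : ℂ => x - w) := by fun_prop
        simpa using this.tendsto w
      simpa using (h4.comp_tendsto h5).norm_norm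
    simpa using h3.norm_right
  exact hda.differentiableAt.differentiableWithinAt

/-- The disk automorphism vanishing at `a`. -/
def mob (a z : ℂ) : ℂ := (z - a) / (1 - (starRingEnd ℂ) a * z)

lemma mob_den_ne {a z : ℂ} (ha : a ∈ unitDisk) (hz : ‖z‖ ≤ 1) :
    1 - (starRingEnd ℂ) a * z ≠ 0 := by
  rw [mem_unitDisk] at ha
  intro h
  have : (1 : ℂ) = (starRingEnd ℂ) a * z := by linear_combination h
  have h2 : (1 : ℝ) = ‖a‖ * ‖z‖ := by
    have := congrArg norm this
    simpa using this
  nlinarith [norm_nonneg a, norm_nonneg z]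

lemma mob_identity (a z : ℂ) :
    ‖1 - (starRingEnd ℂ) a * z‖ ^ 2 - ‖z - a‖ ^ 2 = (1 - ‖a‖ ^ 2) * (1 - ‖z‖ ^ 2) := by
  simp only [Complex.sq_norm, Complex.normSq_apply]
  simp
  ring

lemma schur_mob {a : ℂ} (ha : a ∈ unitDisk) : SchurFn (mob a) := by
  constructor
  · intro z hz
    have := mob_den_ne ha (mem_unitDisk.1 hz).le
    apply DifferentiableAt.differentiableWithinAt
    unfold mob
    fun_prop (disch := assumption)
  · intro z hz
    have h0 := mob_den_ne ha (mem_unitDisk.1 hz).le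
    have h1 := mob_identity a z
    rw [mem_unitDisk] at ha hz
    unfold mob
    rw [norm_div, div_le_one (norm_pos_iff.2 h0)]
    apply le_of_sq_le_sq _ (norm_nonneg _)
    have : 0 ≤ (1 - ‖a‖ ^ 2) * (1 - ‖z‖ ^ 2) := by
      apply mul_nonneg <;> nlinarith [norm_nonneg a, norm_nonneg z]
    linarith

lemma schur_div {g : ℂ → ℂ} (hg : SchurFn g) {a : ℂ} (ha : a ∈ unitDisk) (hga : g a = 0) :
    ∃ h, SchurFn h ∧ ∀ z ∈ unitDisk, g z = mob a z * h z := by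
  have hdiff : DifferentiableOn ℂ (fun z => dslope g a z * (1 - (starRingEnd ℂ) a * z)) unitDisk :=
    ((Complex.differentiableOn_dslope (isOpen_unitDisk.mem_nhds ha)).2 hg.1).mul (by fun_prop)
  have heq : ∀ z, g z = (z - a) * dslope g a z := by
    intro z
    have := sub_smul_dslope g a z
    rw [hga, sub_zero, smul_eq_mul] at this
    exact this.symm
  refine ⟨fun z => dslope g a z * (1 - (starRingEnd ℂ) a * z), ⟨hdiff, ?_⟩, ?_⟩
  · intro z hz
    rw [mem_unitDisk] at ha hz
    have ha0 := norm_nonneg a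
    -- bound on circles of radius close to one
    have hb : ∀ ρ : ℝ, ‖a‖ < ρ → ‖z‖ < ρ → ρ < 1 → 
        ‖dslope g a z * (1 - (starRingEnd ℂ) a * z)‖ ^ 2 * (1 - (1 - ρ ^ 2) * (1 - ‖a‖ ^ 2) / (1 - ‖a‖) ^ 2) ≤ 1 := by
      intro ρ h1 h2 h3
      by_cases hpos : 0 < 1 - (1 - ρ ^ 2) * (1 - ‖a‖ ^ 2) / (1 - ‖a‖) ^ 2
      swap
      · exact (mul_nonpos_of_nonneg_of_nonpos (sq_nonneg _) (not_lt.1 hpos)).trans zero_le_one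
      have hρ0 : 0 < ρ := lt_of_le_of_lt ha0 h1
      set κ := 1 - (1 - ρ ^ 2) * (1 - ‖a‖ ^ 2) / (1 - ‖a‖) ^ 2 with hκ
      rw [← le_div_iff₀ hpos]
      suffices ‖dslope g a z * (1 - (starRingEnd ℂ) a * z)‖ ≤ √(1 / κ) by
        calc _ ≤ √(1 / κ) ^ 2 := by gcongr
          _ = 1 / κ := Real.sq_sqrt (by positivity)
      apply Complex.norm_le_of_forall_mem_frontier_norm_le (U := Metric.ball 0 ρ)
        (f := fun z => dslope g a z * (1 - (starRingEnd ℂ) a * z)) Metric.isBounded_ball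
      · apply DifferentiableOn.diffContOnCl
        rw [closure_ball _ hρ0.ne']
        apply hdiff.mono
        intro x hx
        rw [mem_unitDisk]
        have : ‖x‖ ≤ ρ := by simpa using hx
        linarith
      · intro x hx
        rw [frontier_ball _ hρ0.ne'] at hx
        have hx : ‖x‖ = ρ := by simpa using hx
        have hxd : x ∈ unitDisk := by rw [mem_unitDisk]; linarith
        apply Real.le_sqrt_of_sq_le
        rw [le_div_iff₀ hpos]
        have hxa : x - a ≠ 0 := by
          intro h
          rw [sub_eq_zero] at h
          rw [h] at hx; linarith
        have e1 : dslope g a x = g x / (x - a) := by rw [heq x]; field_simp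
        have hden : (1 - ‖a‖) ≤ ‖1 - (starRingEnd ℂ) a * x‖ := by
          have := norm_sub_norm_le (1 : ℂ) ((starRingEnd ℂ) a * x)
          simp only [norm_one, norm_mul, RCLike.norm_conj] at this
          nlinarith
        have hden2 : (1 - ‖a‖) ^ 2 ≤ ‖1 - (starRingEnd ℂ) a * x‖ ^ 2 := by
          have : 0 ≤ 1 - ‖a‖ := by linarith
          gcongr
        have hid := mob_identity a x
        rw [hx] at hid
        set D := ‖1 - (starRingEnd ℂ) a * x‖ ^ 2
        have hD : 0 < D := lt_of_lt_of_le (by nlinarith) hden2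
        have hxa' : 0 < ‖x - a‖ ^ 2 := by positivity
        have hk : κ * D ≤ ‖x - a‖ ^ 2 := by
          have : (1 - ρ ^ 2) * (1 - ‖a‖ ^ 2) / D ≤ (1 - ρ ^ 2) * (1 - ‖a‖ ^ 2) / (1 - ‖a‖) ^ 2 := by
            apply div_le_div_of_nonneg_left _ (by nlinarith) hden2
            apply mul_nonneg <;> nlinarith
          have h6 : κ ≤ 1 - (1 - ρ ^ 2) * (1 - ‖a‖ ^ 2) / D := by linarith
          calc κ * D ≤ (1 - (1 - ρ ^ 2) * (1 - ‖a‖ ^ 2) / D) * D := by gcongr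
            _ = D - (1 - ρ ^ 2) * (1 - ‖a‖ ^ 2) := by field_simp
            _ = ‖x - a‖ ^ 2 := by linarith
        have hgx : ‖g x‖ ^ 2 ≤ 1 := by
          have := hg.2 x hxd
          nlinarith [norm_nonneg (g x)]
        rw [e1, norm_mul, norm_div, mul_pow, div_pow]
        calc ‖g x‖ ^ 2 / ‖x - a‖ ^ 2 * D * κ = ‖g x‖ ^ 2 * (κ * D) / ‖x - a‖ ^ 2 := by ring
          _ ≤ 1 * ‖x - a‖ ^ 2 / ‖x - a‖ ^ 2 := by gcongr
          _ = 1 := by field_simp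
      · apply subset_closure; simpa using h2
    have hlim : Tendsto (fun ρ : ℝ => ‖dslope g a z * (1 - (starRingEnd ℂ) a * z)‖ ^ 2 * (1 - (1 - ρ ^ 2) * (1 - ‖a‖ ^ 2) / (1 - ‖a‖) ^ 2)) (𝓝[<] 1) (𝓝 (‖dslope g a z * (1 - (starRingEnd ℂ) a * z)‖ ^ 2 * (1 - (1 - 1 ^ 2) * (1 - ‖a‖ ^ 2) / (1 - ‖a‖) ^ 2))) := by
      apply Tendsto.mono_left _ nhdsWithin_le_nhds
      apply Continuous.tendsto (f := fun ρ : ℝ => ‖dslope g a z * (1 - (starRingEnd ℂ) a * z)‖ ^ 2 * (1 - (1 - ρ ^ 2) * (1 - ‖a‖ ^ 2) / (1 - ‖a‖) ^ 2))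
      fun_prop
    have := le_of_tendsto hlim (by
      filter_upwards [self_mem_nhdsWithin, mem_nhdsWithin_of_mem_nhds (Ioi_mem_nhds ha),
        mem_nhdsWithin_of_mem_nhds (Ioi_mem_nhds hz)] with ρ h1 h2 h3
      exact hb ρ h2 h3 h1)
    simp only [one_pow, sub_self, zero_mul, zero_div, sub_zero, mul_one] at this
    have h0 := norm_nonneg (dslope g a z * (1 - (starRingEnd ℂ) a * z))
    nlinarith
  · intro z hz
    have := mob_den_ne ha (mem_unitDisk.1 hz).le
    rw [heq z, mob, div_mul_eq_mul_div, eq_div_iff this]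
    ring

lemma half_sum_norm {ζ₀ ζ : ℂ} (h0 : ‖ζ₀‖ = 1) (h : ‖ζ‖ = 1) :
    ‖(ζ₀ + ζ) / 2‖ ^ 2 = 1 - ‖ζ - ζ₀‖ ^ 2 / 4 := by
  have h1 : ‖ζ₀‖ ^ 2 = 1 := by rw [h0]; norm_num
  have h2 : ‖ζ‖ ^ 2 = 1 := by rw [h]; norm_num
  rw [norm_div, div_pow]
  simp only [Complex.sq_norm, Complex.normSq_apply] at *
  simp at *
  ring_nf at *
  linarith

lemma half_sum_le {ζ₀ z : ℂ} (h0 : ‖ζ₀‖ = 1) (h : ‖z‖ ≤ 1) : ‖(ζ₀ + z) / 2‖ ≤ 1 := by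
  rw [norm_div]
  have := norm_add_le ζ₀ z
  have h2 : ‖(2 : ℂ)‖ = 2 := by simp
  rw [h2]
  linarith

/-- Maximum principle with an exceptional boundary point. -/
lemma peak_bound {G : ℂ → ℂ} {ζ₀ : ℂ} (h0 : ‖ζ₀‖ = 1) (hcont : Continuous G)
    (hdiff : DifferentiableOn ℂ G unitDisk) {M ε : ℝ} (hM : 0 ≤ M) (hε : 0 < ε)
    (hG : ∀ z, ‖G z‖ ≤ M * ‖z - ζ₀‖) (N : ℕ)
    (hb : ∀ ζ, ‖ζ‖ = 1 → ‖G ζ‖ * ‖(ζ₀ + ζ) / 2‖ ^ N ≤ ε * ‖ζ - ζ₀‖) {z : ℂ} (hz : z ∈ unitDisk) :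
    ‖G z‖ * ‖(ζ₀ + z) / 2‖ ^ N ≤ ε * ‖z - ζ₀‖ := by
  have hzne : ∀ x ∈ unitDisk, x - ζ₀ ≠ 0 := by
    intro x hx h
    rw [sub_eq_zero] at h
    rw [mem_unitDisk, h, h0] at hx
    exact lt_irrefl _ hx
  have hpos : 0 < ‖z - ζ₀‖ := norm_pos_iff.2 (hzne z hz)
  set x := ‖G z‖ * ‖(ζ₀ + z) / 2‖ ^ N / (ε * ‖z - ζ₀‖) with hx
  suffices x ≤ 1 by
    rw [hx, div_le_one (by positivity)] at this
    exact this
  have hpow : ∀ m : ℕ, x ^ m ≤ 2 / ‖z - ζ₀‖ := by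
    intro m
    set K : ℂ → ℂ := fun w => (w - ζ₀) * (G w / (w - ζ₀) * ((ζ₀ + w) / 2) ^ N) ^ m with hK
    have hbd : ∀ w, ‖w‖ ≤ 1 → ‖K w‖ ≤ ‖w - ζ₀‖ * M ^ m := by
      intro w hw
      simp only [hK, norm_mul, norm_pow, norm_div (G w)]
      gcongr
      calc ‖G w‖ / ‖w - ζ₀‖ * ‖(ζ₀ + w) / 2‖ ^ N ≤ M * 1 := by
            gcongr
            · exact div_le_of_le_mul₀ (norm_nonneg _) hM (hG w)
            · exact pow_le_one₀ (norm_nonneg _) (half_sum_le h0 hw)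
        _ = M := mul_one _
    have hKb : ‖K z‖ ≤ 2 * ε ^ m := by
      apply Complex.norm_le_of_forall_mem_frontier_norm_le (U := unitDisk) Metric.isBounded_ball
        _ _ (subset_closure hz)
      · constructor
        · intro w hw
          have := hzne w hw
          have hGd := hdiff.differentiableAt (isOpen_unitDisk.mem_nhds hw)
          apply DifferentiableAt.differentiableWithinAt
          simp only [hK]
          fun_prop (disch := assumption)
        · intro w hw
          rw [unitDisk, closure_ball _ one_ne_zero] at hw ⊢
          by_cases hne : w - ζ₀ = 0
          · have hwe : w = ζ₀ := sub_eq_zero.1 hne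
            subst hwe
            have hKw : K w = 0 := by simp [hK]
            rw [ContinuousWithinAt, hKw]
            apply squeeze_zero_norm' (a := fun v => ‖v - w‖ * M ^ m)
            · filter_upwards [self_mem_nhdsWithin] with v hv
              exact hbd v (by simpa using hv)
            · have : Continuous fun v => ‖v - w‖ * M ^ m := by fun_prop
              have := this.tendsto w
              simp only [sub_self, norm_zero, zero_mul] at this
              exact this.mono_left nhdsWithin_le_nhds
          · apply ContinuousAt.continuousWithinAt
            have hGc := hcont.continuousAt (x := w)
            simp only [hK]
            fun_prop (disch := assumption)
      · intro w hw
        rw [unitDisk, frontier_ball _ one_ne_zero] at hw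
        have hw : ‖w‖ = 1 := by simpa using hw
        by_cases hne : w - ζ₀ = 0
        · simp only [hK, hne]; simp; positivity
        · have hp : 0 < ‖w - ζ₀‖ := norm_pos_iff.2 hne
          simp only [hK, norm_mul, norm_pow, norm_div (G w)]
          gcongr
          · calc ‖w - ζ₀‖ ≤ ‖w‖ + ‖ζ₀‖ := norm_sub_le _ _
              _ = 2 := by rw [hw, h0]; norm_num
          · rw [div_mul_eq_mul_div, div_le_iff₀ hp]
            exact hb w hw
    simp only [hK, norm_mul, norm_pow, norm_div (G z)] at hKb
    rw [le_div_iff₀ hpos, hx]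
    have e : (‖G z‖ * ‖(ζ₀ + z) / 2‖ ^ N / (ε * ‖z - ζ₀‖)) ^ m * ‖z - ζ₀‖ =
      (‖z - ζ₀‖ * (‖G z‖ / ‖z - ζ₀‖ * ‖(ζ₀ + z) / 2‖ ^ N) ^ m) / ε ^ m := by
      rw [mul_comm ε, ← div_div, div_pow _ ε, div_mul_eq_mul_div, mul_comm]
      congr 3
      ring
    rw [e, div_le_iff₀ (by positivity)]
    exact hKb
  by_contra hx1
  push Not at hx1
  have := tendsto_pow_atTop_atTop_of_one_lt hx1
  obtain ⟨m, hm⟩ := (this.eventually_gt_atTop (2 / ‖z - ζ₀‖)).exists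
  exact absurd (hpow m) (not_le.2 hm)

lemma fatou_point {F f : ℂ → ℂ} {K : ℝ≥0} (hF : LipschitzWith K F)
    (hd : ∀ z ∈ unitDisk, HasDerivAt F (f z) z) {ζ₀ c : ℂ} (h0 : ‖ζ₀‖ = 1)
    (hc : ∀ ε > 0, ∃ δ > 0, ∀ ζ, ‖ζ‖ = 1 → ‖ζ - ζ₀‖ < δ →
      ‖F ζ - F ζ₀ - c * (ζ - ζ₀)‖ ≤ ε * ‖ζ - ζ₀‖) :
    Tendsto (fun r : ℝ => f (r * ζ₀)) (𝓝[<] 1) (𝓝 c) := by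
  set G : ℂ → ℂ := fun z => F z - F ζ₀ - c * (z - ζ₀) with hGdef
  have hGd : ∀ z ∈ unitDisk, HasDerivAt G (f z - c) z := by
    intro z hz
    have := ((hd z hz).sub_const (F ζ₀)).sub (((hasDerivAt_id z).sub_const ζ₀).const_mul c)
    rw [mul_one] at this
    exact this
  have hGc : Continuous G := by
    have := hF.continuous
    fun_prop
  have hGdiff : DifferentiableOn ℂ G unitDisk := fun z hz =>
    (hGd z hz).differentiableAt.differentiableWithinAt
  set M : ℝ := K + ‖c‖ with hM
  have hM0 : 0 ≤ M := by positivity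
  have hGM : ∀ z, ‖G z‖ ≤ M * ‖z - ζ₀‖ := by
    intro z
    calc ‖G z‖ ≤ ‖F z - F ζ₀‖ + ‖c * (z - ζ₀)‖ := norm_sub_le _ _
      _ ≤ K * ‖z - ζ₀‖ + ‖c‖ * ‖z - ζ₀‖ := by
        rw [norm_mul]
        gcongr
        have := hF.dist_le_mul z ζ₀
        rwa [dist_eq_norm, dist_eq_norm] at this
      _ = _ := by rw [hM]; ring
  -- interior smallness
  have hint : ∀ ε > 0, ∃ δ > 0, ∀ z ∈ unitDisk, ‖z - ζ₀‖ < δ → ‖G z‖ ≤ ε * ‖z - ζ₀‖ := by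
    intro ε hε
    obtain ⟨δ, hδ, hδ'⟩ := hc (ε / 2) (by positivity)
    -- choose N
    have hlim : Tendsto (fun n : ℕ => (max 0 (1 - δ ^ 2 / 4)) ^ n * M) atTop (𝓝 (0 * M)) := by
      apply Tendsto.mul_const
      apply tendsto_pow_atTop_nhds_zero_of_lt_one (le_max_left _ _)
      apply max_lt one_pos
      have : 0 < δ ^ 2 := by positivity
      linarith
    rw [zero_mul] at hlim
    obtain ⟨N, hN⟩ := (hlim.eventually_lt_const (show 0 < ε / 2 by positivity)).exists
    have hpk : ∀ z ∈ unitDisk, ‖G z‖ * ‖(ζ₀ + z) / 2‖ ^ (2 * N) ≤ ε / 2 * ‖z - ζ₀‖ := by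
      intro z hz
      apply peak_bound h0 hGc hGdiff hM0 (by positivity) hGM (2 * N) _ hz
      intro ζ hζ
      by_cases hn : ‖ζ - ζ₀‖ < δ
      · calc ‖G ζ‖ * ‖(ζ₀ + ζ) / 2‖ ^ (2 * N) ≤ ε / 2 * ‖ζ - ζ₀‖ * 1 := by
              gcongr
              · exact hδ' ζ hζ hn
              · exact pow_le_one₀ (norm_nonneg _) (half_sum_le h0 hζ.le)
          _ = _ := mul_one _
      · push Not at hn
        rw [pow_mul, half_sum_norm h0 hζ]
        have h1 : 0 ≤ 1 - ‖ζ - ζ₀‖ ^ 2 / 4 := by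
          rw [← half_sum_norm h0 hζ]; positivity
        calc ‖G ζ‖ * (1 - ‖ζ - ζ₀‖ ^ 2 / 4) ^ N
            ≤ (M * ‖ζ - ζ₀‖) * (max 0 (1 - δ ^ 2 / 4)) ^ N := by
              gcongr
              · exact hGM ζ
              · apply le_max_of_le_right
                gcongr
          _ = ((max 0 (1 - δ ^ 2 / 4)) ^ N * M) * ‖ζ - ζ₀‖ := by ring
          _ ≤ _ := by gcongr
    have hw : Tendsto (fun z : ℂ => ‖(ζ₀ + z) / 2‖ ^ (2 * N)) (𝓝 ζ₀) (𝓝 1) := by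
      have : Continuous (fun z : ℂ => ‖(ζ₀ + z) / 2‖ ^ (2 * N)) := by fun_prop
      have := this.tendsto ζ₀
      simpa [h0] using this
    obtain ⟨δ', hδ'0, hball⟩ := Metric.eventually_nhds_iff.1
      (hw.eventually_const_lt (show (1 / 2 : ℝ) < 1 by norm_num))
    refine ⟨δ', hδ'0, fun z hz hzn => ?_⟩
    have h1 := hball (y := z) (by rwa [dist_eq_norm])
    have h2 := hpk z hz
    have h3 := norm_nonneg (G z)
    nlinarith
  rw [Metric.tendsto_nhdsWithin_nhds]
  intro ε hε
  obtain ⟨δ, hδ, hδ'⟩ := hint (ε / 12) (by positivity)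
  refine ⟨min (δ / 2) 1, by positivity, ?_⟩
  intro r hr hrd
  rw [Set.mem_Iio] at hr
  rw [Real.dist_eq, abs_sub_comm, abs_of_pos (by linarith)] at hrd
  have hr1 : 1 - r < δ / 2 := lt_of_lt_of_le hrd (min_le_left _ _)
  have hr2 : 1 - r < 1 := lt_of_lt_of_le hrd (min_le_right _ _)
  have hρ : 0 < 1 - r := by linarith
  have hnr : ‖(r : ℂ) * ζ₀‖ = r := by
    rw [norm_mul, h0, Complex.norm_real, Real.norm_of_nonneg (by linarith), mul_one]
  have hnr2 : ‖(r : ℂ) * ζ₀ - ζ₀‖ = 1 - r := by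
    have : (r : ℂ) * ζ₀ - ζ₀ = ((r - 1 : ℝ) : ℂ) * ζ₀ := by push_cast; ring
    rw [this, norm_mul, h0, Complex.norm_real, mul_one, Real.norm_eq_abs, abs_sub_comm, abs_of_pos hρ]
  have hsub : ∀ z ∈ Metric.ball ((r : ℂ) * ζ₀) (1 - r), z ∈ unitDisk ∧ ‖z - ζ₀‖ < 2 * (1 - r) := by
    intro z hz
    rw [Metric.mem_ball, dist_eq_norm] at hz
    constructor
    · rw [mem_unitDisk]
      have : ‖z‖ ≤ ‖z - r * ζ₀‖ + ‖(r : ℂ) * ζ₀‖ := by simpa using norm_add_le (z - r * ζ₀) (r * ζ₀)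
      linarith
    · have : ‖z - ζ₀‖ ≤ ‖z - r * ζ₀‖ + ‖(r : ℂ) * ζ₀ - ζ₀‖ := by
        simpa using norm_add_le (z - r * ζ₀) (r * ζ₀ - ζ₀)
      linarith
  have hGb : ∀ z ∈ Metric.ball ((r : ℂ) * ζ₀) (1 - r), ‖G z‖ ≤ ε / 12 * (2 * (1 - r)) := by
    intro z hz
    obtain ⟨h1, h2⟩ := hsub z hz
    exact (hδ' z h1 (by linarith)).trans (by gcongr)
  have hc0 := Metric.mem_ball_self (x := (r : ℂ) * ζ₀) hρ
  have hder := Complex.norm_deriv_le_div_of_mapsTo_ball (f := G) (c := (r : ℂ) * ζ₀)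
    (R₁ := 1 - r) (R₂ := ε / 3 * (1 - r)) (hGdiff.mono fun z hz => (hsub z hz).1) (by
      intro z hz
      rw [Metric.mem_closedBall, dist_eq_norm]
      have h1 := hGb z hz
      have h2 := hGb _ hc0
      have := norm_sub_le (G z) (G (r * ζ₀))
      linarith) hρ
  rw [(hGd _ (hsub _ hc0).1).deriv, mul_div_assoc, div_self hρ.ne', mul_one] at hder
  rw [dist_eq_norm]
  linarith

theorem fatou_schur {u : ℂ → ℂ} (hu : SchurFn u) :
    ∀ᵐ θ : ℝ, ∃ l, Tendsto (fun r : ℝ => u (circlePt r θ)) (𝓝[<] 1) (𝓝 l) := by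
  obtain ⟨g, hg⟩ := (show DifferentiableOn ℂ u (Metric.ball 0 1) from hu.1).isExactOn_ball
  have hLip : LipschitzOnWith 1 g (Metric.ball 0 1) :=
    (convex_ball (0 : ℂ) 1).lipschitzOnWith_of_nnnorm_hasDerivWithin_le
      (fun x hx => (hg x hx).hasDerivWithinAt) (fun x hx => hu.2 x hx)
  obtain ⟨F, hF, hFg⟩ := hLip.extend_finite_dimension
  have hd : ∀ z ∈ unitDisk, HasDerivAt F (u z) z := by
    intro z hz
    apply (hg z hz).congr_of_eventuallyEq
    filter_upwards [isOpen_unitDisk.mem_nhds hz] with x hx using (hFg hx).symm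
  have hexp : LipschitzWith 1 (fun θ : ℝ => Complex.exp (θ * Complex.I)) := by
    apply LipschitzWith.of_dist_le_mul
    intro x y
    have : Complex.exp (x * Complex.I) - Complex.exp (y * Complex.I) =
        Complex.exp (y * Complex.I) * (Complex.exp (Complex.I * ((x - y : ℝ) : ℂ)) - 1) := by
      rw [mul_sub, ← Complex.exp_add, mul_one]
      congr 2
      push_cast; ring
    rw [dist_eq_norm, dist_eq_norm, this, norm_mul, Complex.norm_exp_ofReal_mul_I]
    simpa using Real.norm_exp_I_mul_ofReal_sub_one_le (x := x - y)
  filter_upwards [(hF.comp hexp).ae_differentiableAt] with θ hθ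
  set ζ₀ := Complex.exp (θ * Complex.I) with hζ₀
  have h0 : ‖ζ₀‖ = 1 := Complex.norm_exp_ofReal_mul_I θ
  have hzetane : ζ₀ ≠ 0 := Complex.exp_ne_zero _
  obtain ⟨D, hD⟩ : ∃ D, HasDerivAt (F ∘ fun θ : ℝ => Complex.exp (θ * Complex.I)) D θ :=
    ⟨_, hθ.hasDerivAt⟩
  set c := D / (ζ₀ * Complex.I) with hcdef
  refine ⟨c, ?_⟩
  apply fatou_point hF hd h0
  intro ε hε
  have hE : HasDerivAt (fun t : ℝ => Complex.exp (t * Complex.I)) (ζ₀ * Complex.I) θ := by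
    have h1 : HasDerivAt (fun t : ℂ => Complex.exp (t * Complex.I)) (ζ₀ * Complex.I) (θ : ℂ) := by
      simpa using ((hasDerivAt_id (θ : ℂ)).mul_const Complex.I).cexp
    exact h1.comp_ofReal
  have hφ := (hD.sub_const (F ζ₀)).sub ((hE.sub_const ζ₀).const_mul c)
  have hz : D - c * (ζ₀ * Complex.I) = 0 := by
    rw [hcdef]
    have := Complex.I_ne_zero
    field_simp
    simp
  rw [hz, hasDerivAt_iff_isLittleO] at hφ
  have hφ' := hφ.def (show 0 < ε * (2 / π) by positivity)
  rw [Metric.eventually_nhds_iff] at hφ'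
  obtain ⟨δ, hδ, hδ'⟩ := hφ'
  refine ⟨δ * (2 / π), by positivity, ?_⟩
  intro ζ hζ hζd
  have hζne : ζ ≠ 0 := by rw [← norm_pos_iff, hζ]; norm_num
  set a := (ζ / ζ₀).arg with ha
  have hle : 2 / π * |a| ≤ ‖ζ - ζ₀‖ := by
    have := (Complex.norm_sub_mem_Icc_angle hζ h0).1
    rwa [Complex.angle_eq_abs_arg hζne hzetane] at this
  have hζe : Complex.exp (((θ + a : ℝ) : ℂ) * Complex.I) = ζ := by
    have h1 : Complex.exp (a * Complex.I) = ζ / ζ₀ := by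
      have := Complex.norm_mul_exp_arg_mul_I (ζ / ζ₀)
      rwa [norm_div, hζ, h0, div_one, Complex.ofReal_one, one_mul] at this
    push_cast
    rw [add_mul, Complex.exp_add, h1, ← hζ₀]
    field_simp
  have hπ : 0 < 2 / π := by positivity
  have hda : |a| < δ := by
    by_contra hcon
    push Not at hcon
    nlinarith
  have := hδ' (y := θ + a) (by simpa [Real.dist_eq] using hda)
  simp only [Pi.sub_apply, Function.comp_apply, ← hζ₀, hζe, sub_self, mul_zero, sub_zero, smul_zero, add_sub_cancel_left, Real.norm_eq_abs] at this
  calc _ ≤ _ := this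
    _ = ε * (2 / π * |a|) := by ring
    _ ≤ _ := by gcongr

lemma circlePt_norm (r θ : ℝ) : ‖circlePt r θ‖ = |r| := by
  simp [circlePt, Complex.norm_exp_ofReal_mul_I]

lemma circlePt_mem {r : ℝ} (hr : r ∈ Ico (0 : ℝ) 1) (θ : ℝ) : circlePt r θ ∈ unitDisk := by
  rw [mem_unitDisk, circlePt_norm, abs_of_nonneg hr.1]; exact hr.2

lemma circlePt_eq (r θ : ℝ) : circlePt r θ = circleMap 0 r θ := by simp [circlePt, circleMap]

lemma continuous_circlePt (r : ℝ) : Continuous (circlePt r) := by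
  unfold circlePt; fun_prop

lemma continuous_comp_circlePt {f : ℂ → ℂ} (hf : DifferentiableOn ℂ f unitDisk) {r : ℝ}
    (hr : r ∈ Ico (0 : ℝ) 1) : Continuous fun θ => f (circlePt r θ) :=
  hf.continuousOn.comp_continuous (continuous_circlePt r) (circlePt_mem hr)

lemma two_pi_ofReal_ne_zero : ENNReal.ofReal (2 * π) ≠ 0 := by
  simp [Real.pi_pos]

lemma mem_Np_iff {p : ℝ} {f : ℂ → ℂ} : f ∈ NpClass p ↔ DifferentiableOn ℂ f unitDisk ∧
    ∃ B : ℝ≥0∞, B ≠ ∞ ∧ ∀ r ∈ Ico (0 : ℝ) 1, ∫⁻ θ in Set.Ioc 0 (2 * π),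
        ENNReal.ofReal (Real.log ‖f (circlePt r θ)‖) ^ p ≤ B := by
  unfold NpClass
  simp only [mem_ofPred_eq, and_congr_right_iff]
  intro _
  constructor
  · intro h
    refine ⟨_, (ENNReal.mul_lt_top h (ENNReal.ofReal_lt_top (r := 2 * π))).ne, ?_⟩
    intro r hr
    rw [← ENNReal.div_le_iff two_pi_ofReal_ne_zero ENNReal.ofReal_ne_top]
    exact le_iSup₂ (f := fun r (_ : r ∈ Ico (0 : ℝ) 1) => (∫⁻ θ in Set.Ioc 0 (2 * π),
        ENNReal.ofReal (Real.log ‖f (circlePt r θ)‖) ^ p) / ENNReal.ofReal (2 * π)) r hr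
  · rintro ⟨B, hB, h⟩
    refine lt_of_le_of_lt (b := B / ENNReal.ofReal (2 * π)) ?_ (ENNReal.div_lt_top hB two_pi_ofReal_ne_zero)
    refine iSup₂_le fun r hr => ?_
    gcongr
    exact h r hr

lemma log_one_add_le {x : ℝ} (hx : 0 ≤ x) : 
    ENNReal.ofReal (Real.log (1 + x)) ≤ ENNReal.ofReal (Real.log 2) + ENNReal.ofReal (Real.log x) := by
  by_cases h : x ≤ 1
  · refine le_add_right ?_
    apply ENNReal.ofReal_le_ofReal
    apply Real.log_le_log <;> linarith
  · push Not at h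
    rw [← ENNReal.ofReal_add (Real.log_nonneg (by norm_num)) (Real.log_nonneg h.le),
      ← Real.log_mul (by norm_num) (by linarith)]
    apply ENNReal.ofReal_le_ofReal
    apply Real.log_le_log <;> linarith

lemma Np_log_bound {p : ℝ} (hp : 1 < p) {f : ℂ → ℂ} (hf : f ∈ NpClass p) (A : ℝ≥0∞) (hA : A ≠ ∞) :
    ∃ B : ℝ≥0∞, B ≠ ∞ ∧ ∀ r ∈ Ico (0 : ℝ) 1, ∫⁻ θ in Set.Ioc 0 (2 * π),
        (A + ENNReal.ofReal (Real.log ‖f (circlePt r θ)‖)) ^ p ≤ B := by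
  obtain ⟨hd, B, hB, h⟩ := mem_Np_iff.1 hf
  refine ⟨2 ^ (p - 1) * (A ^ p * volume (Ioc 0 (2 * π)) + B), ?_, ?_⟩
  · apply ENNReal.mul_ne_top
    · exact ENNReal.rpow_ne_top_of_nonneg (by linarith) (by norm_num)
    · apply ENNReal.add_ne_top.2 ⟨ENNReal.mul_ne_top ?_ ?_, hB⟩
      · exact ENNReal.rpow_ne_top_of_nonneg (by linarith) hA
      · exact measure_Ioc_lt_top.ne
  · intro r hr
    calc _ ≤ ∫⁻ θ in Set.Ioc 0 (2 * π), 2 ^ (p - 1) * (A ^ p + ENNReal.ofReal (Real.log ‖f (circlePt r θ)‖) ^ p) := by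
          apply lintegral_mono
          intro θ
          exact ENNReal.rpow_add_le_mul_rpow_add_rpow _ _ hp.le
      _ = 2 ^ (p - 1) * (A ^ p * volume (Ioc 0 (2 * π)) + ∫⁻ θ in Set.Ioc 0 (2 * π), ENNReal.ofReal (Real.log ‖f (circlePt r θ)‖) ^ p) := by
          rw [lintegral_const_mul' _ _ (ENNReal.rpow_ne_top_of_nonneg (by linarith) (by norm_num)),
            lintegral_add_left measurable_const]
          simp
      _ ≤ _ := by gcongr; exact h r hr

lemma Np_log1p_bound {p : ℝ} (hp : 1 < p) {f : ℂ → ℂ} (hf : f ∈ NpClass p) :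
    ∃ B : ℝ≥0∞, B ≠ ∞ ∧ ∀ r ∈ Ico (0 : ℝ) 1, ∫⁻ θ in Set.Ioc 0 (2 * π),
        (ENNReal.ofReal (Real.log (1 + ‖f (circlePt r θ)‖))) ^ p ≤ B := by
  obtain ⟨B, hB, h⟩ := Np_log_bound hp hf (ENNReal.ofReal (Real.log 2)) ENNReal.ofReal_ne_top
  refine ⟨B, hB, fun r hr => le_trans (lintegral_mono fun θ => ?_) (h r hr)⟩
  exact ENNReal.rpow_le_rpow (log_one_add_le (norm_nonneg _)) (by linarith)

lemma Np_of_le {p : ℝ} (hp : 1 < p) {f q : ℂ → ℂ} (hf : f ∈ NpClass p)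
    (hq : DifferentiableOn ℂ q unitDisk) (C : ℝ)
    (hle : ∀ z ∈ unitDisk, ‖q z‖ ≤ C * (1 + ‖f z‖)) : q ∈ NpClass p := by
  obtain ⟨B, hB, h⟩ := Np_log_bound hp hf (ENNReal.ofReal (Real.log (max C 1)) + ENNReal.ofReal (Real.log 2))
    (ENNReal.add_ne_top.2 ⟨ENNReal.ofReal_ne_top, ENNReal.ofReal_ne_top⟩)
  refine mem_Np_iff.2 ⟨hq, B, hB, fun r hr => le_trans (lintegral_mono fun θ => ?_) (h r hr)⟩
  refine ENNReal.rpow_le_rpow ?_ (by linarith)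
  have hx := hle _ (circlePt_mem hr θ)
  have h0 := norm_nonneg (f (circlePt r θ))
  rw [add_assoc]
  refine le_trans ?_ (add_le_add_right (log_one_add_le h0) _)
  rw [← ENNReal.ofReal_add (Real.log_nonneg (le_max_right _ _)) (Real.log_nonneg (by linarith)),
    ← Real.log_mul (by positivity) (by positivity)]
  by_cases hq0 : ‖q (circlePt r θ)‖ = 0
  · rw [hq0]; simp
  apply ENNReal.ofReal_le_ofReal
  apply Real.log_le_log (lt_of_le_of_ne (norm_nonneg _) (Ne.symm hq0))
  refine hx.trans ?_
  gcongr
  exact le_max_left _ _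

lemma zero_mem_Np {p : ℝ} (hp : 1 < p) : (0 : ℂ → ℂ) ∈ NpClass p := by
  refine mem_Np_iff.2 ⟨by fun_prop, 0, by simp, fun r _ => ?_⟩
  simp [ENNReal.zero_rpow_of_pos (show 0 < p by linarith)]

lemma Np_of_bdd {p : ℝ} (hp : 1 < p) {q : ℂ → ℂ} 
    (hq : DifferentiableOn ℂ q unitDisk) (C : ℝ)
    (hle : ∀ z ∈ unitDisk, ‖q z‖ ≤ C) : q ∈ NpClass p :=
  Np_of_le hp (zero_mem_Np hp) hq C (fun z hz => by simpa using hle z hz)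

lemma SchurFn.mem_Np {p : ℝ} (hp : 1 < p) {q : ℂ → ℂ} (hq : SchurFn q) : q ∈ NpClass p :=
  Np_of_bdd hp hq.1 1 hq.2

lemma schur_sq_integral {u : ℂ → ℂ} (hu : SchurFn u) {r : ℝ} (hr : r ∈ Ico (0 : ℝ) 1) :
    ∫⁻ θ in Set.Ioc 0 (2 * π), ‖u (circlePt r θ) - 1‖ₑ ^ 2 ≤
      ENNReal.ofReal (4 * π * (1 - (u 0).re)) := by
  have hc := continuous_comp_circlePt hu.1 hr
  have hcre : Continuous fun θ => (u (circlePt r θ)).re := Complex.continuous_re.comp hc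
  have hle : ∀ θ, ‖u (circlePt r θ) - 1‖ₑ ^ 2 ≤ ENNReal.ofReal (2 - 2 * (u (circlePt r θ)).re) := by
    intro θ
    rw [← ofReal_norm, ← ENNReal.ofReal_pow (norm_nonneg _)]
    apply ENNReal.ofReal_le_ofReal
    have h1 := hu.2 _ (circlePt_mem hr θ)
    have h2 : ‖u (circlePt r θ)‖ ^ 2 ≤ 1 := pow_le_one₀ (norm_nonneg _) h1
    rw [Complex.sq_norm, Complex.normSq_apply] at h2 ⊢
    simp only [Complex.sub_re, Complex.one_re, Complex.sub_im, Complex.one_im]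
    nlinarith
  refine (lintegral_mono hle).trans ?_
  rw [← ofReal_integral_eq_lintegral_ofReal]
  · apply ENNReal.ofReal_le_ofReal
    rw [← intervalIntegral.integral_of_le (by positivity)]
    have hmv : Real.circleAverage u 0 r = u 0 := by
      apply DiffContOnCl.circleAverage
      rw [abs_of_nonneg hr.1]
      apply DifferentiableOn.diffContOnCl
      apply hu.1.mono
      refine Metric.closure_ball_subset_closedBall.trans ?_
      exact Metric.closedBall_subset_ball hr.2
    rw [Real.circleAverage_def] at hmv
    have h3 : ∫ θ in (0 : ℝ)..2 * π, u (circleMap 0 r θ) = (2 * π : ℝ) • u 0 := by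
      rw [← hmv, smul_smul, mul_inv_cancel₀ (by positivity), one_smul]
    have h4 : ∫ θ in (0 : ℝ)..2 * π, (u (circlePt r θ)).re = 2 * π * (u 0).re := by
      have := Complex.reCLM.intervalIntegral_comp_comm (μ := volume) (hc.intervalIntegrable 0 (2 * π))
      simp only [Complex.reCLM_apply] at this
      rw [this]
      simp only [circlePt_eq]
      rw [h3]
      simp
    rw [intervalIntegral.integral_sub (by simp) (by
      exact (continuous_const.mul hcre).intervalIntegrable _ _), intervalIntegral.integral_const_mul, h4]
    simp
    linarith
  · apply Continuous.integrableOn_Ioc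
    exact continuous_const.sub (continuous_const.mul hcre)
  · apply Eventually.of_forall
    intro θ
    have h1 := hu.2 _ (circlePt_mem hr θ)
    have := Complex.re_le_norm (u (circlePt r θ))
    simp only [Pi.zero_apply]
    linarith

/-- The junk value of `radialLimit`. -/
def junkC : ℂ := Classical.epsilon fun _ : ℂ => False

lemma radialLimit_of_not {f : ℂ → ℂ} {θ : ℝ}
    (h : ¬ ∃ l, Tendsto (fun r : ℝ => f (circlePt r θ)) (𝓝[<] 1) (𝓝 l)) :
    radialLimit f θ = junkC := by
  unfold radialLimit junkC limUnder lim
  congr 1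
  funext x
  simp only [eq_iff_iff, iff_false]
  exact fun hx => h ⟨x, hx⟩

lemma radialLimit_of_tendsto {f : ℂ → ℂ} {θ : ℝ} {l : ℂ}
    (h : Tendsto (fun r : ℝ => f (circlePt r θ)) (𝓝[<] 1) (𝓝 l)) :
    radialLimit f θ = l := h.limUnder_eq

/-- A sequence of radii tending to one. -/
def rad (k : ℕ) : ℝ := 1 - 1 / ((k : ℝ) + 2)

lemma rad_mem (k : ℕ) : rad k ∈ Ico (0 : ℝ) 1 := by
  unfold rad
  have h : (0 : ℝ) ≤ k := Nat.cast_nonneg k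
  constructor
  · rw [sub_nonneg, div_le_one (by positivity)]; linarith
  · rw [sub_lt_self_iff]; positivity

lemma rad_tendsto' : Tendsto rad atTop (𝓝 1) := by
  have h1 : Tendsto (fun k : ℕ => (k : ℝ) + 2) atTop atTop :=
    tendsto_atTop_add_const_right _ _ tendsto_natCast_atTop_atTop
  have h2 : Tendsto (fun k : ℕ => 1 - 1 / ((k : ℝ) + 2)) atTop (𝓝 (1 - 0)) := by
    apply Tendsto.sub tendsto_const_nhds
    simp only [one_div]
    exact h1.inv_tendsto_atTop
  rw [sub_zero] at h2
  exact h2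

lemma rad_tendsto : Tendsto rad atTop (𝓝[<] 1) :=
  tendsto_nhdsWithin_iff.2 ⟨rad_tendsto', Eventually.of_forall fun k => (rad_mem k).2⟩

/-- Fatou-type lower limit of the logarithmic integrand. -/
def logInf (p : ℝ) (h : ℂ → ℂ) (θ : ℝ) : ℝ≥0∞ :=
  liminf (fun k => ENNReal.ofReal (Real.log (1 + ‖h (circlePt (rad k) θ)‖)) ^ p) atTop

/-- Fatou-type lower limit of the squared distance to one. -/
def sqInf (u : ℂ → ℂ) (θ : ℝ) : ℝ≥0∞ :=
  liminf (fun k => ‖u (circlePt (rad k) θ) - 1‖ₑ ^ 2) atTop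

lemma measurable_logTerm {h : ℂ → ℂ} (hh : DifferentiableOn ℂ h unitDisk) (p : ℝ) (k : ℕ) :
    Measurable fun θ => ENNReal.ofReal (Real.log (1 + ‖h (circlePt (rad k) θ)‖)) ^ p := by
  have hc := (continuous_comp_circlePt hh (rad_mem k)).measurable
  exact ((Real.measurable_log.comp (hc.norm.const_add 1)).ennreal_ofReal).pow_const p

lemma measurable_logInf {h : ℂ → ℂ} (hh : DifferentiableOn ℂ h unitDisk) (p : ℝ) :
    Measurable (logInf p h) :=
  Measurable.liminf fun k => measurable_logTerm hh p k

lemma measurable_sqTerm {h : ℂ → ℂ} (hh : DifferentiableOn ℂ h unitDisk) (k : ℕ) :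
    Measurable fun θ => ‖h (circlePt (rad k) θ) - 1‖ₑ ^ 2 := by
  have hc := (continuous_comp_circlePt hh (rad_mem k)).measurable
  exact (hc.sub_const 1).enorm.pow_const 2

lemma measurable_sqInf {h : ℂ → ℂ} (hh : DifferentiableOn ℂ h unitDisk) :
    Measurable (sqInf h) :=
  Measurable.liminf fun k => measurable_sqTerm hh k

lemma lintegral_logInf {p : ℝ} (hp : 1 < p) {h : ℂ → ℂ} (hh : h ∈ NpClass p) :
    ∫⁻ θ in Set.Ioc 0 (2 * π), logInf p h θ ≠ ∞ := by
  obtain ⟨B, hB, h1⟩ := Np_log1p_bound hp hh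
  refine ne_top_of_le_ne_top hB ?_
  unfold logInf
  refine (lintegral_liminf_le fun k => measurable_logTerm hh.1 p k).trans ?_
  refine liminf_le_of_frequently_le' ?_
  exact Frequently.of_forall fun k => h1 _ (rad_mem k)

lemma lintegral_sqInf {u : ℂ → ℂ} (hu : SchurFn u) :
    ∫⁻ θ in Set.Ioc 0 (2 * π), sqInf u θ ≤ ENNReal.ofReal (4 * π * (1 - (u 0).re)) := by
  unfold sqInf
  refine (lintegral_liminf_le fun k => measurable_sqTerm hu.1 k).trans ?_
  refine liminf_le_of_frequently_le' ?_
  exact Frequently.of_forall fun k => schur_sq_integral hu (rad_mem k)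

lemma sqInf_of_tendsto {u : ℂ → ℂ} {θ : ℝ} {l : ℂ}
    (h : Tendsto (fun r : ℝ => u (circlePt r θ)) (𝓝[<] 1) (𝓝 l)) :
    sqInf u θ = ‖l - 1‖ₑ ^ 2 := by
  have h1 := h.comp rad_tendsto
  have hc : Continuous fun z : ℂ => ‖z - 1‖ₑ ^ 2 := by
    apply Continuous.comp (g := fun x : ℝ≥0∞ => x ^ 2)
    · exact ENNReal.continuous_pow 2
    · fun_prop
  exact ((hc.tendsto l).comp h1).liminf_eq

lemma continuous_logterm (p : ℝ) : Continuous fun x : ℝ => ENNReal.ofReal (Real.log (1 + |x|)) ^ p := by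
  refine ENNReal.continuous_rpow_const.comp (ENNReal.continuous_ofReal.comp ?_)
  refine Continuous.log (by fun_prop) fun x => ?_
  have := abs_nonneg x
  linarith

lemma log_le_logInf {p : ℝ} (hp : 1 < p) {h g : ℂ → ℂ} (hgh : ∀ z ∈ unitDisk, ‖g z‖ ≤ ‖h z‖)
    {θ : ℝ} {l : ℂ} (hl : Tendsto (fun r : ℝ => g (circlePt r θ)) (𝓝[<] 1) (𝓝 l)) :
    ENNReal.ofReal (Real.log (1 + ‖l‖)) ≤ logInf p h θ ^ (1 / p) := by
  have h1 := (hl.comp rad_tendsto).norm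
  have h2 := ((continuous_logterm p).tendsto _).comp h1
  simp only [Function.comp_def, abs_norm] at h2
  have h3 : ENNReal.ofReal (Real.log (1 + ‖l‖)) ^ p ≤ logInf p h θ := by
    rw [← h2.liminf_eq]
    refine liminf_le_liminf (Eventually.of_forall fun k => ?_)
    refine ENNReal.rpow_le_rpow (ENNReal.ofReal_le_ofReal ?_) (by linarith)
    apply Real.log_le_log (by positivity)
    have := hgh _ (circlePt_mem (rad_mem k) θ)
    linarith
  rw [one_div]
  exact (ENNReal.le_rpow_inv_iff (by linarith)).2 h3

/-- Constant measuring the junk value. -/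
def kap : ℝ≥0∞ := ENNReal.ofReal (Real.log (1 + ‖junkC‖))

lemma log_radialLimit_le {p : ℝ} (hp : 1 < p) {h g : ℂ → ℂ} (hgh : ∀ z ∈ unitDisk, ‖g z‖ ≤ ‖h z‖)
    (θ : ℝ) :
    ENNReal.ofReal (Real.log (1 + ‖radialLimit g θ‖)) ≤ logInf p h θ ^ (1 / p) + kap := by
  by_cases hl : ∃ l, Tendsto (fun r : ℝ => g (circlePt r θ)) (𝓝[<] 1) (𝓝 l)
  · obtain ⟨l, hl⟩ := hl
    rw [radialLimit_of_tendsto hl]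
    exact (log_le_logInf hp hgh hl).trans le_self_add
  · rw [radialLimit_of_not hl]
    exact le_add_self

lemma log_one_add_sub_le (a b : ℂ) : ENNReal.ofReal (Real.log (1 + ‖a - b‖)) ≤
    ENNReal.ofReal (Real.log (1 + ‖a‖)) + ENNReal.ofReal (Real.log (1 + ‖b‖)) := by
  have ha := norm_nonneg a
  have hb := norm_nonneg b
  rw [← ENNReal.ofReal_add (Real.log_nonneg (by linarith)) (Real.log_nonneg (by linarith)),
    ← Real.log_mul (by positivity) (by positivity)]
  apply ENNReal.ofReal_le_ofReal
  apply Real.log_le_log (by positivity)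
  have := norm_sub_le a b
  nlinarith

/-- Dominating function. -/
def domF (p : ℝ) (h : ℂ → ℂ) (θ : ℝ) : ℝ≥0∞ :=
  ((logInf p h θ ^ (1 / p) + kap) + (logInf p h θ ^ (1 / p) + kap)) ^ p

/-- Majorant of the integrand in the metric. -/
def majF (p : ℝ) (h u : ℂ → ℂ) (θ : ℝ) : ℝ≥0∞ :=
  if sqInf u θ < 1 then
    min (domF p h θ) (ENNReal.ofReal (Real.log
      (1 + |Real.exp (logInf p h θ ^ (1 / p)).toReal * √(sqInf u θ).toReal|)) ^ p)
  else domF p h θ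

lemma measurable_domF {p : ℝ} {h : ℂ → ℂ} (hh : DifferentiableOn ℂ h unitDisk) :
    Measurable (domF p h) := by
  have := measurable_logInf hh p
  unfold domF
  fun_prop

lemma measurable_majF {p : ℝ} {h u : ℂ → ℂ} (hh : DifferentiableOn ℂ h unitDisk)
    (hu : DifferentiableOn ℂ u unitDisk) : Measurable (majF p h u) := by
  have h1 := measurable_logInf hh p
  have h2 := measurable_sqInf hu
  unfold majF
  refine Measurable.ite (measurableSet_lt h2 measurable_const) ?_ (measurable_domF hh)
  refine (measurable_domF hh).min ?_
  refine (continuous_logterm p).measurable.comp ?_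
  fun_prop

lemma lintegral_domF {p : ℝ} (hp : 1 < p) {h : ℂ → ℂ} (hh : h ∈ NpClass p) :
    ∫⁻ θ in Set.Ioc 0 (2 * π), domF p h θ ≠ ∞ := by
  have h1 := lintegral_logInf hp hh
  have hk : (2 * kap) ^ p ≠ ∞ := ENNReal.rpow_ne_top_of_nonneg (by linarith)
    (ENNReal.mul_ne_top (by norm_num) ENNReal.ofReal_ne_top)
  have h2p : (2 : ℝ≥0∞) ^ p ≠ ∞ := ENNReal.rpow_ne_top_of_nonneg (by linarith) (by norm_num)
  have h2p' : (2 : ℝ≥0∞) ^ (p - 1) ≠ ∞ := ENNReal.rpow_ne_top_of_nonneg (by linarith) (by norm_num)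
  have hle : ∀ θ, domF p h θ ≤ 2 ^ (p - 1) * (2 ^ p * logInf p h θ + (2 * kap) ^ p) := by
    intro θ
    unfold domF
    have e : (logInf p h θ ^ (1 / p) + kap) + (logInf p h θ ^ (1 / p) + kap) =
      2 * logInf p h θ ^ (1 / p) + 2 * kap := by ring
    rw [e]
    refine (ENNReal.rpow_add_le_mul_rpow_add_rpow _ _ hp.le).trans ?_
    rw [ENNReal.mul_rpow_of_nonneg 2 (logInf p h θ ^ (1 / p)) (show 0 ≤ p by linarith),
      ← ENNReal.rpow_mul, one_div_mul_cancel (by linarith), ENNReal.rpow_one]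
  refine ne_top_of_le_ne_top ?_ (lintegral_mono hle)
  rw [lintegral_const_mul' _ _ h2p', lintegral_add_right _ measurable_const,
    lintegral_const_mul' _ _ h2p]
  refine ENNReal.mul_ne_top h2p' (ENNReal.add_ne_top.2 ⟨ENNReal.mul_ne_top h2p h1, ?_⟩)
  rw [setLIntegral_const]
  exact ENNReal.mul_ne_top hk measure_Ioc_lt_top.ne

lemma majF_le {p : ℝ} {h u : ℂ → ℂ} (θ : ℝ) : majF p h u θ ≤ domF p h θ := by
  unfold majF
  split_ifs
  · exact min_le_left _ _
  · exact le_rfl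

lemma integrand_le_majF {p : ℝ} (hp : 1 < p) {h u : ℂ → ℂ} (hu : SchurFn u) {θ : ℝ}
    (hfin : logInf p h θ ≠ ∞)
    (hlim : ∃ l, Tendsto (fun r : ℝ => u (circlePt r θ)) (𝓝[<] 1) (𝓝 l)) :
    ENNReal.ofReal (Real.log (1 + ‖radialLimit h θ - radialLimit (h * u) θ‖)) ^ p
      ≤ majF p h u θ := by
  have hdom : ENNReal.ofReal (Real.log (1 + ‖radialLimit h θ - radialLimit (h * u) θ‖)) ^ p
      ≤ domF p h θ := by
    refine ENNReal.rpow_le_rpow ((log_one_add_sub_le _ _).trans ?_) (by linarith)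
    refine add_le_add (log_radialLimit_le hp (fun z _ => le_rfl) θ)
      (log_radialLimit_le hp (fun z hz => ?_) θ)
    rw [Pi.mul_apply, norm_mul]
    exact mul_le_of_le_one_right (norm_nonneg _) (hu.2 z hz)
  unfold majF
  split_ifs with hD
  · refine le_min hdom ?_
    obtain ⟨l, hl⟩ := hlim
    have hs := sqInf_of_tendsto hl
    have hl0 : l ≠ 0 := by
      rintro rfl
      rw [hs] at hD
      simp at hD
    by_cases ha : ∃ a, Tendsto (fun r : ℝ => h (circlePt r θ)) (𝓝[<] 1) (𝓝 a)
    · obtain ⟨a, ha⟩ := ha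
      have hal : Tendsto (fun r : ℝ => (h * u) (circlePt r θ)) (𝓝[<] 1) (𝓝 (a * l)) := ha.mul hl
      rw [radialLimit_of_tendsto ha, radialLimit_of_tendsto hal]
      refine ENNReal.rpow_le_rpow (ENNReal.ofReal_le_ofReal ?_) (by linarith)
      apply Real.log_le_log (by positivity)
      have h1 : ‖a‖ ≤ Real.exp (logInf p h θ ^ (1 / p)).toReal := by
        have h2 := log_le_logInf hp (h := h) (fun z _ => le_rfl) ha
        have h3 := (ENNReal.ofReal_le_iff_le_toReal
          (ENNReal.rpow_ne_top_of_nonneg (by positivity) hfin)).1 h2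
        have h4 := (Real.log_le_iff_le_exp (by positivity)).1 h3
        linarith
      have h5 : √(sqInf u θ).toReal = ‖l - 1‖ := by
        rw [hs]
        simp [Real.sqrt_sq]
      have h6 : a - a * l = - (a * (l - 1)) := by ring
      rw [h5, h6, norm_neg, norm_mul, abs_of_nonneg (by positivity)]
      gcongr
    · have hal : ¬ ∃ b, Tendsto (fun r : ℝ => (h * u) (circlePt r θ)) (𝓝[<] 1) (𝓝 b) := by
        rintro ⟨b, hb⟩
        apply ha
        refine ⟨b / l, (hb.div hl hl0).congr' ?_⟩
        filter_upwards [hl.eventually_ne hl0] with r hr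
        simp [hr]
      rw [radialLimit_of_not ha, radialLimit_of_not hal]
      simp [ENNReal.zero_rpow_of_pos (show 0 < p by linarith)]
  · exact hdom

lemma majF_tendsto {p : ℝ} (hp : 1 < p) {h : ℂ → ℂ} {u : ℕ → ℂ → ℂ} {θ : ℝ}
    (hD : Tendsto (fun n => sqInf (u n) θ) atTop (𝓝 0)) :
    Tendsto (fun n => majF p h (u n) θ) atTop (𝓝 0) := by
  have h1 : Tendsto (fun n => (sqInf (u n) θ).toReal) atTop (𝓝 0) := by
    have := (ENNReal.tendsto_toReal ENNReal.zero_ne_top).comp hD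
    simpa [Function.comp_def] using this
  have h2 : Tendsto (fun n => Real.exp (logInf p h θ ^ (1 / p)).toReal * √(sqInf (u n) θ).toReal)
      atTop (𝓝 0) := by
    have := ((Real.continuous_sqrt.tendsto _).comp h1).const_mul
      (Real.exp (logInf p h θ ^ (1 / p)).toReal)
    simpa using this
  have h3 := ((continuous_logterm p).tendsto _).comp h2
  simp only [abs_zero, add_zero, Real.log_one, ENNReal.ofReal_zero,
    ENNReal.zero_rpow_of_pos (show 0 < p by linarith)] at h3
  refine tendsto_of_tendsto_of_tendsto_of_le_of_le' tendsto_const_nhds h3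
    (Eventually.of_forall fun n => zero_le) ?_
  filter_upwards [hD.eventually (gt_mem_nhds (show (0 : ℝ≥0∞) < 1 by norm_num))] with n hn
  unfold majF
  rw [if_pos hn]
  exact min_le_right _ _

lemma dense_of_schur {p : ℝ} (hp : 1 < p) {I : Set (ℂ → ℂ)} (hI : IsIdealInNp p I)
    (u : ℕ → ℂ → ℂ) (huI : ∀ n, u n ∈ I) (hu : ∀ n, SchurFn (u n))
    (h1 : Tendsto (fun n => u n 0) atTop (𝓝 1)) : IsDenseInNp p I := by
  intro h hh ε hε
  have hex : ∀ n : ℕ, ∃ m, ‖u m 0 - 1‖ < (1 / 2 : ℝ) ^ n := by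
    intro n
    have := (Metric.tendsto_atTop.1 h1) ((1 / 2 : ℝ) ^ n) (by positivity)
    obtain ⟨N, hN⟩ := this
    exact ⟨N, by simpa [dist_eq_norm] using hN N le_rfl⟩
  choose m hm using hex
  let v : ℕ → ℂ → ℂ := fun n => u (m n)
  have hv : ∀ n, SchurFn (v n) := fun n => hu _
  let μ : Measure ℝ := volume.restrict (Ioc 0 (2 * π))
  have hDn : ∀ n, ∫⁻ θ, sqInf (v n) θ ∂μ ≤ ENNReal.ofReal (4 * π) * (ENNReal.ofReal (1 / 2)) ^ n := by
    intro n
    refine (lintegral_sqInf (hv n)).trans ?_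
    rw [← ENNReal.ofReal_pow (by norm_num), ← ENNReal.ofReal_mul (by positivity)]
    apply ENNReal.ofReal_le_ofReal
    have h2 := (Complex.abs_re_le_norm (v n 0 - 1)).trans (hm n).le
    rw [Complex.sub_re, Complex.one_re] at h2
    have := (abs_le.1 h2).1
    gcongr
    linarith
  have hsum : ∫⁻ θ, ∑' n, sqInf (v n) θ ∂μ ≠ ∞ := by
    rw [lintegral_tsum fun n => (measurable_sqInf (hv n).1).aemeasurable]
    refine ne_top_of_le_ne_top ?_ (ENNReal.tsum_le_tsum hDn)
    rw [ENNReal.tsum_mul_left, ENNReal.tsum_geometric]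
    refine ENNReal.mul_ne_top ENNReal.ofReal_ne_top ?_
    rw [ENNReal.inv_ne_top]
    refine (tsub_pos_of_lt ?_).ne'
    rw [ENNReal.ofReal_lt_one]
    norm_num
  have hDlim : ∀ᵐ θ ∂μ, Tendsto (fun n => sqInf (v n) θ) atTop (𝓝 0) := by
    have hmeas : Measurable fun θ => ∑' n, sqInf (v n) θ :=
      Measurable.tsum fun n => measurable_sqInf (hv n).1
    filter_upwards [ae_lt_top hmeas hsum] with θ hθ
    exact ENNReal.tendsto_atTop_zero_of_tsum_ne_top hθ.ne
  have hmaj : Tendsto (fun n => ∫⁻ θ, majF p h (v n) θ ∂μ) atTop (𝓝 (∫⁻ θ, 0 ∂μ)) := by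
    refine tendsto_lintegral_of_dominated_convergence (domF p h)
      (fun n => measurable_majF hh.1 (hv n).1) (fun n => Eventually.of_forall majF_le)
      (lintegral_domF hp hh) ?_
    filter_upwards [hDlim] with θ hθ
    exact majF_tendsto hp hθ
  have hfin : ∀ᵐ θ ∂μ, logInf p h θ ≠ ∞ := by
    filter_upwards [ae_lt_top (measurable_logInf hh.1 p) (lintegral_logInf hp hh)] with θ hθ
    exact hθ.ne
  have hle : ∀ n, dMetric p h (h * v n) ≤
      ((∫⁻ θ, majF p h (v n) θ ∂μ) / ENNReal.ofReal (2 * π)) ^ (1 / p) := by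
    intro n
    unfold dMetric
    refine ENNReal.rpow_le_rpow (ENNReal.div_le_div_right (lintegral_mono_ae ?_) _) (by positivity)
    filter_upwards [hfin, ae_restrict_of_ae (fatou_schur (hv n))] with θ h2 h3
    exact integrand_le_majF hp (hv n) h2 h3
  have hlim : Tendsto (fun n => ((∫⁻ θ, majF p h (v n) θ ∂μ) / ENNReal.ofReal (2 * π)) ^ (1 / p))
      atTop (𝓝 0) := by
    rw [lintegral_zero] at hmaj
    have h2 := ENNReal.Tendsto.div_const hmaj (b := ENNReal.ofReal (2 * π))
      (Or.inr two_pi_ofReal_ne_zero)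
    have h3 := (ENNReal.continuous_rpow_const (y := 1 / p)).tendsto _ |>.comp h2
    simpa [Function.comp_def, ENNReal.zero_rpow_of_pos (show 0 < p⁻¹ by positivity)] using h3
  obtain ⟨n, hn⟩ := (hlim.eventually (gt_mem_nhds hε)).exists
  exact ⟨h * v n, hI.mul_mem _ hh _ (huI _), (hle n).trans_lt hn⟩

lemma span_fourier_re (g : C(AddCircle (2 * π), ℂ))
    (hg : g ∈ Submodule.span ℂ (range (@fourier (2 * π)))) :
    ∀ c : ℂ, ∃ Q : Polynomial ℂ, ∀ x : AddCircle (2 * π),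
      (c * g x).re = (Q.eval ((AddCircle.toCircle x : Circle) : ℂ)).re := by
  induction hg using Submodule.span_induction with
  | mem g hg =>
    obtain ⟨n, rfl⟩ := hg
    intro c
    rcases Int.le_total 0 n with hn | hn
    · obtain ⟨m, rfl⟩ := Int.eq_ofNat_of_zero_le hn
      refine ⟨Polynomial.C c * Polynomial.X ^ m, fun x => ?_⟩
      simp [fourier_apply, AddCircle.toCircle_nsmul]
    · obtain ⟨m, hm⟩ := Int.eq_ofNat_of_zero_le (show 0 ≤ -n by omega)
      obtain rfl : n = -(m : ℤ) := by omega
      refine ⟨Polynomial.C (starRingEnd ℂ c) * Polynomial.X ^ m, fun x => ?_⟩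
      rw [fourier_neg, ← Complex.conj_re]
      simp [fourier_apply, AddCircle.toCircle_nsmul]
  | zero => exact fun c => ⟨0, fun x => by simp⟩
  | add g h _ _ ihg ihh =>
    intro c
    obtain ⟨Q, hQ⟩ := ihg c
    obtain ⟨R, hR⟩ := ihh c
    refine ⟨Q + R, fun x => ?_⟩
    rw [Polynomial.eval_add, Complex.add_re, ← hQ, ← hR, ← Complex.add_re, ContinuousMap.add_apply,
      mul_add]
  | smul a g _ ih =>
    intro c
    obtain ⟨Q, hQ⟩ := ih (c * a)
    refine ⟨Q, fun x => ?_⟩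
    rw [← hQ, ContinuousMap.smul_apply, smul_eq_mul, mul_assoc]

lemma trig_approx (W : ℂ → ℝ) (hW : ContinuousOn W (Metric.sphere 0 1)) :
    ∃ Q : Polynomial ℂ, ∀ ζ : ℂ, ‖ζ‖ = 1 → |W ζ - (Q.eval ζ).re| ≤ 1 := by
  have : Fact (0 < 2 * π) := ⟨Real.two_pi_pos⟩
  have hc : Continuous fun x : AddCircle (2 * π) =>
      ((W ((AddCircle.toCircle x : Circle) : ℂ) : ℝ) : ℂ) := by
    refine Complex.continuous_ofReal.comp (hW.comp_continuous ?_ ?_)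
    · exact continuous_subtype_val.comp AddCircle.continuous_toCircle
    · intro x; simpa using Circle.norm_coe _
  let V : C(AddCircle (2 * π), ℂ) := ⟨_, hc⟩
  have hV : V ∈ (Submodule.span ℂ (range (@fourier (2 * π)))).topologicalClosure := by
    rw [span_fourier_closure_eq_top]; trivial
  rw [← SetLike.mem_coe, Submodule.topologicalClosure_coe, Metric.mem_closure_iff] at hV
  obtain ⟨g, hg, hd⟩ := hV 1 one_pos
  obtain ⟨Q, hQ⟩ := span_fourier_re g hg 1
  refine ⟨Q, fun ζ hζ => ?_⟩
  obtain ⟨x, hx⟩ : ∃ x : AddCircle (2 * π), ((AddCircle.toCircle x : Circle) : ℂ) = ζ := by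
    refine ⟨((Complex.arg ζ : ℝ) : AddCircle (2 * π)), ?_⟩
    rw [AddCircle.toCircle_apply_mk, div_self (by positivity), one_mul, Circle.coe_exp]
    have := Complex.norm_mul_exp_arg_mul_I ζ
    rwa [hζ, Complex.ofReal_one, one_mul] at this
  have h1 := (ContinuousMap.dist_apply_le_dist (f := V) (g := g) x).trans hd.le
  rw [dist_eq_norm] at h1
  have h2 := (Complex.abs_re_le_norm _).trans h1
  rw [Complex.sub_re] at h2
  have h3 := hQ x
  rw [one_mul] at h3
  rw [h3, hx] at h2
  have h4 : (V x).re = W ζ := by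
    show ((W ((AddCircle.toCircle x : Circle) : ℂ) : ℝ) : ℂ).re = W ζ
    rw [hx, Complex.ofReal_re]
  rwa [h4] at h2

lemma poly_mean_re (Q : Polynomial ℂ) :
    ∫ θ in (0 : ℝ)..2 * π, (Q.eval (circlePt 1 θ)).re = 2 * π * (Q.eval 0).re := by
  have hmv : Real.circleAverage (fun z => Q.eval z) 0 1 = Q.eval 0 := by
    apply DiffContOnCl.circleAverage
    exact Q.differentiable.diffContOnCl
  rw [Real.circleAverage_def] at hmv
  have h3 : ∫ θ in (0 : ℝ)..2 * π, Q.eval (circleMap 0 1 θ) = (2 * π : ℝ) • Q.eval 0 := by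
    rw [← hmv, smul_smul, mul_inv_cancel₀ (by positivity), one_smul]
  have hc : Continuous fun θ => Q.eval (circlePt 1 θ) := Q.continuous.comp (continuous_circlePt 1)
  have := Complex.reCLM.intervalIntegral_comp_comm (μ := volume) (hc.intervalIntegrable 0 (2 * π))
  simp only [Complex.reCLM_apply] at this
  rw [this]
  simp only [circlePt_eq]
  rw [h3]
  simp

lemma real_log_integral {p : ℝ} (hp : 1 < p) {f : ℂ → ℂ} (hf : f ∈ NpClass p) :
    ∃ C : ℝ, ∀ r ∈ Ico (0 : ℝ) 1,
      ∫ θ in (0 : ℝ)..2 * π, Real.log (1 + ‖f (circlePt r θ)‖) ≤ C := by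
  obtain ⟨B, hB, h⟩ := Np_log1p_bound hp hf
  have hfin : volume (Ioc 0 (2 * π)) + B ≠ ∞ := ENNReal.add_ne_top.2 ⟨measure_Ioc_lt_top.ne, hB⟩
  refine ⟨(volume (Ioc 0 (2 * π)) + B).toReal, fun r hr => ?_⟩
  have hc := continuous_comp_circlePt hf.1 hr
  have hlog : Continuous fun θ => Real.log (1 + ‖f (circlePt r θ)‖) := by
    refine Continuous.log (continuous_const.add hc.norm) fun θ => ?_
    positivity
  rw [intervalIntegral.integral_of_le (by positivity), integral_eq_lintegral_of_nonneg_ae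
    (Eventually.of_forall fun θ => Real.log_nonneg (by simp)) hlog.aestronglyMeasurable]
  refine ENNReal.toReal_mono hfin ?_
  calc _ ≤ ∫⁻ θ in Ioc 0 (2 * π), (1 + ENNReal.ofReal (Real.log (1 + ‖f (circlePt r θ)‖)) ^ p) := by
        apply lintegral_mono
        intro θ
        dsimp only
        rcases le_total (ENNReal.ofReal (Real.log (1 + ‖f (circlePt r θ)‖))) 1 with h1 | h1
        · exact h1.trans le_self_add
        · refine le_trans ?_ le_add_self
          exact ENNReal.le_rpow_self_of_one_le h1 hp.le
    _ = volume (Ioc 0 (2 * π)) + ∫⁻ θ in Ioc 0 (2 * π),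
          ENNReal.ofReal (Real.log (1 + ‖f (circlePt r θ)‖)) ^ p := by
        rw [lintegral_add_left measurable_const]
        simp
    _ ≤ _ := by gcongr; exact h r hr

lemma max_mod {F : ℂ → ℂ} (hF : DiffContOnCl ℂ F unitDisk)
    (h : ∀ ζ : ℂ, ‖ζ‖ = 1 → ‖F ζ‖ ≤ 1) {z : ℂ} (hz : z ∈ unitDisk) : ‖F z‖ ≤ 1 := by
  refine Complex.norm_le_of_forall_mem_frontier_norm_le (U := unitDisk) Metric.isBounded_ball hF
    (fun ζ hζ => h ζ ?_) (subset_closure hz)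
  unfold unitDisk at hζ
  rw [frontier_ball _ one_ne_zero] at hζ
  simpa using hζ

lemma multiplier_step {f : ℂ → ℂ} (hf : DifferentiableOn ℂ f unitDisk) {r : ℝ}
    (hr : r ∈ Ico (0 : ℝ) 1) {C : ℝ}
    (hC : ∫ θ in (0 : ℝ)..2 * π, Real.log (1 + ‖f (circlePt r θ)‖) ≤ C) :
    ∃ G, SchurFn G ∧ (∀ z ∈ unitDisk, ‖G z * f (r * z)‖ ≤ 1) ∧
      Real.exp (-(2 + C / (2 * π))) ≤ ‖G 0‖ := by
  have hmaps : MapsTo (fun z : ℂ => (r : ℂ) * z) (Metric.closedBall 0 1) unitDisk := by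
    intro z hz
    rw [mem_unitDisk, norm_mul, Complex.norm_real, Real.norm_eq_abs, abs_of_nonneg hr.1]
    have : ‖z‖ ≤ 1 := by simpa using hz
    have h2 := hr.2
    have h1 := hr.1
    nlinarith [norm_nonneg z]
  have hfr : ContinuousOn (fun z : ℂ => f (r * z)) (Metric.closedBall 0 1) :=
    hf.continuousOn.comp (by fun_prop) hmaps
  have hfrd : DifferentiableOn ℂ (fun z : ℂ => f (r * z)) unitDisk :=
    hf.comp (by fun_prop) (hmaps.mono_left Metric.ball_subset_closedBall)
  obtain ⟨Q, hQ⟩ := trig_approx (fun ζ => Real.log (1 + ‖f (r * ζ)‖) + 1) (by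
    refine ContinuousOn.add (ContinuousOn.log ?_ ?_) continuousOn_const
    · exact continuousOn_const.add (hfr.mono Metric.sphere_subset_closedBall).norm
    · intro z _
      positivity)
  have hQ1 : ∀ ζ : ℂ, ‖ζ‖ = 1 → Real.log (1 + ‖f (r * ζ)‖) ≤ (Q.eval ζ).re := by
    intro ζ hζ
    have := (abs_le.1 (hQ ζ hζ)).2
    linarith
  have hQ2 : ∀ ζ : ℂ, ‖ζ‖ = 1 → (Q.eval ζ).re ≤ Real.log (1 + ‖f (r * ζ)‖) + 2 := by
    intro ζ hζ
    have := (abs_le.1 (hQ ζ hζ)).1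
    linarith
  have hGd : Differentiable ℂ fun z => Complex.exp (-Q.eval z) := Q.differentiable.neg.cexp
  have hGn : ∀ z, ‖Complex.exp (-Q.eval z)‖ = Real.exp (-(Q.eval z).re) := by
    intro z; rw [Complex.norm_exp, Complex.neg_re]
  refine ⟨fun z => Complex.exp (-Q.eval z), ⟨hGd.differentiableOn, fun z hz => ?_⟩, fun z hz => ?_, ?_⟩
  · refine max_mod hGd.diffContOnCl (fun ζ hζ => ?_) hz
    rw [hGn]
    have h1 := hQ1 ζ hζ
    have h2 : 0 ≤ Real.log (1 + ‖f (r * ζ)‖) := Real.log_nonneg (by simp)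
    rw [Real.exp_le_one_iff]
    linarith
  · refine max_mod (F := fun z => Complex.exp (-Q.eval z) * f (r * z)) ?_ (fun ζ hζ => ?_) hz
    · refine ⟨hGd.differentiableOn.mul hfrd, ?_⟩
      unfold unitDisk
      rw [closure_ball _ one_ne_zero]
      exact hGd.continuous.continuousOn.mul hfr
    · rw [norm_mul, hGn, Real.exp_neg]
      have h1 := hQ1 ζ hζ
      rw [Real.log_le_iff_le_exp (by positivity)] at h1
      rw [inv_mul_le_one₀ (Real.exp_pos _)]
      linarith
  · rw [hGn]
    apply Real.exp_le_exp.2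
    have h1 := poly_mean_re Q
    have hc := continuous_comp_circlePt hf hr
    have hlog : Continuous fun θ => Real.log (1 + ‖f (circlePt r θ)‖) := by
      refine Continuous.log (continuous_const.add hc.norm) fun θ => ?_
      positivity
    have h2 : ∫ θ in (0 : ℝ)..2 * π, (Q.eval (circlePt 1 θ)).re ≤
        ∫ θ in (0 : ℝ)..2 * π, (Real.log (1 + ‖f (circlePt r θ)‖) + 2) := by
      apply intervalIntegral.integral_mono_on (by positivity)
      · exact (Complex.continuous_re.comp (Q.continuous.comp
          (continuous_circlePt 1))).intervalIntegrable _ _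
      · exact (hlog.add continuous_const).intervalIntegrable _ _
      · intro θ _
        have := hQ2 (circlePt 1 θ) (by rw [circlePt_norm]; simp)
        have e : (r : ℂ) * circlePt 1 θ = circlePt r θ := by simp [circlePt]
        rwa [e] at this
    rw [intervalIntegral.integral_add (hlog.intervalIntegrable _ _) (by simp), h1] at h2
    simp only [intervalIntegral.integral_const, sub_zero, smul_eq_mul] at h2
    have h3 : 2 * π * (Q.eval 0).re ≤ C + 2 * π * 2 := by linarith
    have hpi : 0 < 2 * π := by positivity
    have h4 : (Q.eval 0).re ≤ 2 + C / (2 * π) := by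
      rw [← mul_le_mul_iff_right₀ hpi, mul_add, mul_div_cancel₀ _ hpi.ne']
      linarith
    linarith

lemma exists_multiplier {p : ℝ} (hp : 1 < p) {f : ℂ → ℂ} (hf : f ∈ NpClass p) :
    ∃ G, SchurFn G ∧ SchurFn (G * f) ∧ G 0 ≠ 0 := by
  obtain ⟨C, hC⟩ := real_log_integral hp hf
  choose G hG1 hG2 hG3 using fun n => multiplier_step hf.1 (rad_mem n) (hC _ (rad_mem n))
  obtain ⟨V, hV, hlim⟩ := ultra_lim G hG1
  refine ⟨V, hV, ⟨hV.1.mul hf.1, fun z hz => ?_⟩, ?_⟩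
  · have h1 : Tendsto (fun n => ((rad n : ℝ) : ℂ) * z) (hyperfilter ℕ : Filter ℕ) (𝓝 z) := by
      have h2 : Tendsto (fun n => ((rad n : ℝ) : ℂ) * z) atTop (𝓝 (((1 : ℝ) : ℂ) * z)) :=
        ((Complex.continuous_ofReal.tendsto 1).comp rad_tendsto').mul_const z
      rw [Complex.ofReal_one, one_mul] at h2
      exact h2.mono_left Nat.hyperfilter_le_atTop
    have h2 : ContinuousAt f z := (hf.1.differentiableAt (isOpen_unitDisk.mem_nhds hz)).continuousAt
    have h3 := ((hlim z hz).mul (h2.tendsto.comp h1)).norm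
    exact le_of_tendsto h3 (Eventually.of_forall fun n => hG2 n z hz)
  · have h3 := (hlim 0 zero_mem_unitDisk).norm
    have h4 := ge_of_tendsto h3 (Eventually.of_forall fun n => hG3 n)
    rw [← norm_pos_iff]
    exact (Real.exp_pos _).trans_le h4

lemma exists_mul_ne_zero {f g : ℂ → ℂ} (hf : DifferentiableOn ℂ f unitDisk)
    (hg : DifferentiableOn ℂ g unitDisk) {a b : ℂ} (ha : a ∈ unitDisk) (hb : b ∈ unitDisk)
    (hfa : f a ≠ 0) (hgb : g b ≠ 0) : ∃ c ∈ unitDisk, c ≠ 0 ∧ f c ≠ 0 ∧ g c ≠ 0 := by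
  have hfA := hf.analyticOnNhd isOpen_unitDisk
  have hgA := hg.analyticOnNhd isOpen_unitDisk
  have hpre : IsPreconnected unitDisk := (convex_ball (0 : ℂ) 1).isPreconnected
  have h1 : ∀ᶠ z in 𝓝[≠] a, f z ≠ 0 :=
    ((hf.differentiableAt (isOpen_unitDisk.mem_nhds ha)).continuousAt.eventually_ne hfa).filter_mono
      nhdsWithin_le_nhds
  have h2 : ∀ᶠ z in 𝓝[≠] a, g z ≠ 0 := by
    rcases (hgA a ha).eventually_eq_zero_or_eventually_ne_zero with h | h
    · exact absurd (hgA.eqOn_zero_of_preconnected_of_eventuallyEq_zero hpre ha h hb) hgb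
    · exact h
  have h3 : ∀ᶠ z in 𝓝[≠] a, z ∈ unitDisk := 
    nhdsWithin_le_nhds (isOpen_unitDisk.mem_nhds ha)
  have h4 : ∀ᶠ z in 𝓝[≠] a, z ≠ 0 := by
    rcases eq_or_ne a 0 with rfl | h
    · exact eventually_mem_nhdsWithin
    · exact nhdsWithin_le_nhds (isOpen_ne.mem_nhds h)
  obtain ⟨c, hc⟩ := (h1.and (h2.and (h3.and h4))).exists
  exact ⟨c, hc.2.2.1, hc.2.2.2, hc.1, hc.2.1⟩

lemma dMetric_of_eqOn {p : ℝ} (hp : 1 < p) {h g : ℂ → ℂ} (hgh : EqOn h g unitDisk) :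
    dMetric p h g = 0 := by
  have h1 : ∀ θ, radialLimit h θ = radialLimit g θ := by
    intro θ
    unfold radialLimit limUnder
    congr 1
    apply Filter.map_congr
    have : Ioo (0 : ℝ) 1 ∈ 𝓝[<] (1 : ℝ) := Ioo_mem_nhdsLT (by norm_num)
    filter_upwards [this] with r hr
    exact hgh (circlePt_mem ⟨hr.1.le, hr.2⟩ θ)
  unfold dMetric
  have hp0 : 0 < p := by linarith
  simp [h1, ENNReal.zero_rpow_of_pos hp0, hp0]

lemma const_mem_Np {p : ℝ} (hp : 1 < p) (c : ℂ) : (fun _ : ℂ => c) ∈ NpClass p :=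
  Np_of_bdd hp (by fun_prop) ‖c‖ fun _ _ => le_rfl

section Ideal

variable {p : ℝ} {I : Set (ℂ → ℂ)}

lemma one_not_mem (hp : 1 < p) (hI : IsPrimeIdealInNp p I) (hnd : ¬ IsDenseInNp p I)
    {q : ℂ → ℂ} (hq : EqOn q 1 unitDisk) : q ∉ I := by
  intro hqI
  apply hnd
  intro h hh ε hε
  refine ⟨h * q, hI.1.mul_mem _ hh _ hqI, ?_⟩
  rw [dMetric_of_eqOn hp]
  · exact hε
  · intro z hz
    simp [hq hz]

lemma vanish_mem (hp : 1 < p) (hI : IsPrimeIdealInNp p I) (hnd : ¬ IsDenseInNp p I)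
    {q : ℂ → ℂ} (hq : EqOn q 0 unitDisk) : q ∈ I := by
  classical
  let e : ℂ → ℂ := fun z => if z ∈ unitDisk then 0 else 1
  have he : EqOn e 0 unitDisk := fun z hz => by simp [e, hz]
  have hNp : ∀ (c : ℂ) (q : ℂ → ℂ), EqOn q (fun _ => c) unitDisk → q ∈ NpClass p := by
    intro c q hq
    refine Np_of_bdd hp ((differentiableOn_const c).congr hq) ‖c‖ fun z hz => ?_
    rw [hq hz]
  have he1 : EqOn (1 - e) 1 unitDisk := fun z hz => by simp [he hz]
  have h1 : e * (1 - e) ∈ I := by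
    have : e * (1 - e) = 0 := by
      funext z
      by_cases hz : z ∈ unitDisk <;> simp [e, hz]
    rw [this]
    exact hI.1.zero_mem
  have heI : e ∈ I := by
    rcases hI.2 e (hNp 0 e he) (1 - e) (hNp 1 _ he1) h1 with h | h
    · exact h
    · exact absurd h (one_not_mem hp hI hnd he1)
  have : q = q * e := by
    funext z
    by_cases hz : z ∈ unitDisk
    · simp [hq hz]
    · simp [e, hz]
  rw [this]
  exact hI.1.mul_mem _ (hNp 0 q hq) _ heI

lemma mem_congr (hp : 1 < p) (hI : IsPrimeIdealInNp p I) (hnd : ¬ IsDenseInNp p I)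
    {f g : ℂ → ℂ} (hf : f ∈ I) (hfg : EqOn g f unitDisk) : g ∈ I := by
  have h1 : g - f ∈ I := vanish_mem hp hI hnd fun z hz => by simp [hfg hz]
  have := hI.1.add_mem _ hf _ h1
  rwa [add_sub_cancel] at this

lemma prime_congr (hp : 1 < p) (hI : IsPrimeIdealInNp p I) (hnd : ¬ IsDenseInNp p I)
    {f g h : ℂ → ℂ} (hh : h ∈ I) (hf : f ∈ NpClass p) (hg : g ∈ NpClass p)
    (hfg : ∀ z ∈ unitDisk, h z = f z * g z) : f ∈ I ∨ g ∈ I :=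
  hI.2 f hf g hg (mem_congr hp hI hnd hh fun z hz => (hfg z hz).symm)

lemma mob_not_mem (hp : 1 < p) (hI : IsPrimeIdealInNp p I) (hnd : ¬ IsDenseInNp p I)
    (hno : ∀ w ∈ unitDisk, (fun z => z - w) ∉ I) {a : ℂ} (ha : a ∈ unitDisk) : mob a ∉ I := by
  intro h
  apply hno a ha
  have h1 : (fun z => 1 - (starRingEnd ℂ) a * z) ∈ NpClass p := by
    refine Np_of_bdd hp (by fun_prop) 2 fun z hz => ?_
    refine (norm_sub_le _ _).trans ?_
    rw [norm_one, norm_mul, RCLike.norm_conj]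
    rw [mem_unitDisk] at ha hz
    nlinarith [norm_nonneg a, norm_nonneg z]
  refine mem_congr hp hI hnd (hI.1.mul_mem _ h1 _ h) fun z hz => ?_
  have := mob_den_ne ha (mem_unitDisk.1 hz).le
  simp only [Pi.mul_apply, mob]
  rw [mul_div_cancel₀ _ this]

lemma SchurFn.mul {f g : ℂ → ℂ} (hf : SchurFn f) (hg : SchurFn g) :
    SchurFn fun z => f z * g z :=
  ⟨hf.1.mul hg.1, fun z hz => by
    rw [norm_mul]; exact mul_le_one₀ (hf.2 z hz) (norm_nonneg _) (hg.2 z hz)⟩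

lemma schurFn_one : SchurFn fun _ => 1 := ⟨by fun_prop, by simp⟩

lemma schurFn_prod {β : ℕ → ℂ → ℂ} (hβ : ∀ n, SchurFn (β n)) (s : Finset ℕ) :
    SchurFn fun z => ∏ i ∈ s, β i z := by
  classical
  induction s using Finset.induction_on with
  | empty => simpa using schurFn_one
  | insert a s ha ih =>
    simp only [Finset.prod_insert ha]
    exact (hβ a).mul ih

lemma prod_not_mem (hp : 1 < p) (hI : IsPrimeIdealInNp p I) (hnd : ¬ IsDenseInNp p I)
    {β : ℕ → ℂ → ℂ} (hβ : ∀ n, SchurFn (β n)) (hn : ∀ n, β n ∉ I) (s : Finset ℕ) :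
    (fun z => ∏ i ∈ s, β i z) ∉ I := by
  classical
  induction s using Finset.induction_on with
  | empty => exact one_not_mem hp hI hnd fun z _ => by simp
  | insert a s ha ih =>
    intro h
    rcases prime_congr hp hI hnd h ((hβ a).mem_Np hp) ((schurFn_prod hβ s).mem_Np hp)
      (fun z _ => Finset.prod_insert ha) with h | h
    · exact hn a h
    · exact ih h

lemma root_mem (hp : 1 < p) (hI : IsPrimeIdealInNp p I) (hnd : ¬ IsDenseInNp p I)
    {f g : ℂ → ℂ} (hf : SchurFn f) (hg : g ∈ I) (n : ℕ)
    (h : ∀ z ∈ unitDisk, f z ^ n = g z) : f ∈ I := by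
  by_contra hn
  refine prod_not_mem hp hI hnd (β := fun _ => f) (fun _ => hf) (fun _ => hn) (Finset.range n) ?_
  refine mem_congr hp hI hnd hg fun z hz => ?_
  simp [h z hz]

/-- Removing the zeros at the origin. -/
lemma exists_ne_zero_at_zero (hp : 1 < p) (hI : IsPrimeIdealInNp p I) (hnd : ¬ IsDenseInNp p I)
    (hno : ∀ w ∈ unitDisk, (fun z => z - w) ∉ I) {c : ℂ} (hc : c ∈ unitDisk) (hc0 : c ≠ 0)
    (n : ℕ) : ∀ b ∈ I, SchurFn b → ‖c‖ ^ n < ‖b c‖ → ∃ b ∈ I, SchurFn b ∧ b 0 ≠ 0 := by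
  induction n with
  | zero =>
    intro b _ hb h
    have := hb.2 c hc
    rw [pow_zero] at h
    linarith
  | succ n ih =>
    intro b hbI hb h
    by_cases h0 : b 0 = 0
    · obtain ⟨h1, hh1, hfac⟩ := schur_div hb zero_mem_unitDisk h0
      have hI1 : h1 ∈ I := (prime_congr hp hI hnd hbI ((schur_mob zero_mem_unitDisk).mem_Np hp)
        (hh1.mem_Np hp) hfac).resolve_left (mob_not_mem hp hI hnd hno zero_mem_unitDisk)
      refine ih h1 hI1 hh1 ?_
      have := hfac c hc
      rw [this, norm_mul, pow_succ'] at h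
      have e : mob 0 c = c := by simp [mob]
      rw [e] at h
      exact lt_of_mul_lt_mul_left h (norm_nonneg _)
    · exact ⟨b, hbI, hb, h0⟩

lemma factor_step (hp : 1 < p) (hI : IsPrimeIdealInNp p I) (hnd : ¬ IsDenseInNp p I)
    (hno : ∀ w ∈ unitDisk, (fun z => z - w) ∉ I) {r : ℝ} (hr : r ∈ Ico (0 : ℝ) 1) (n : ℕ) :
    ∀ g, SchurFn g → r ^ n < ‖g 0‖ → ∃ β h, SchurFn β ∧ SchurFn h ∧ β ∉ I ∧
      (∀ z ∈ unitDisk, g z = β z * h z) ∧ ∀ z, ‖z‖ ≤ r → h z ≠ 0 := by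
  induction n with
  | zero =>
    intro g hg h
    have := hg.2 0 zero_mem_unitDisk
    rw [pow_zero] at h
    linarith
  | succ n ih =>
    intro g hg h
    by_cases hz : ∀ z, ‖z‖ ≤ r → g z ≠ 0
    · exact ⟨fun _ => 1, g, schurFn_one, hg, one_not_mem hp hI hnd fun z _ => rfl, by simp, hz⟩
    · push Not at hz
      obtain ⟨a, har, ha⟩ := hz
      have haD : a ∈ unitDisk := mem_unitDisk.2 (har.trans_lt hr.2)
      obtain ⟨h1, hh1, hfac⟩ := schur_div hg haD ha
      have h2 : r ^ n < ‖h1 0‖ := by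
        rw [hfac 0 zero_mem_unitDisk, norm_mul, pow_succ'] at h
        have e : ‖mob a 0‖ = ‖a‖ := by simp [mob]
        rw [e] at h
        refine lt_of_mul_lt_mul_left (h.trans_le ?_) hr.1
        gcongr
      obtain ⟨β, k, hβ, hk, hβI, hfac2, hkz⟩ := ih h1 hh1 h2
      refine ⟨fun z => mob a z * β z, k, (schur_mob haD).mul hβ, hk, ?_, ?_, hkz⟩
      · intro hm
        rcases prime_congr hp hI hnd hm ((schur_mob haD).mem_Np hp) (hβ.mem_Np hp)
          (fun z _ => rfl) with h | h
        · exact mob_not_mem hp hI hnd hno haD h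
        · exact hβI h
      · intro z hz
        rw [hfac z hz, hfac2 z hz, mul_assoc]

lemma factor (hp : 1 < p) (hI : IsPrimeIdealInNp p I) (hnd : ¬ IsDenseInNp p I)
    (hno : ∀ w ∈ unitDisk, (fun z => z - w) ∉ I) (m : ℕ) {g : ℂ → ℂ} (hg : SchurFn g)
    (hg0 : g 0 ≠ 0) : ∃ β h, SchurFn β ∧ SchurFn h ∧ β ∉ I ∧
      (∀ z ∈ unitDisk, g z = β z * h z) ∧ ∀ z, ‖z‖ ≤ rad m → h z ≠ 0 := by
  obtain ⟨n, hn⟩ := exists_pow_lt_of_lt_one (norm_pos_iff.2 hg0) (rad_mem m).2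
  exact factor_step hp hI hnd hno (rad_mem m) n g hg hn

lemma factor_seq (hp : 1 < p) (hI : IsPrimeIdealInNp p I) (hnd : ¬ IsDenseInNp p I)
    (hno : ∀ w ∈ unitDisk, (fun z => z - w) ∉ I) {b : ℂ → ℂ} (hb : SchurFn b)
    (hb0 : b 0 ≠ 0) : ∃ g β : ℕ → ℂ → ℂ, g 0 = b ∧ (∀ n, SchurFn (g n)) ∧ (∀ n, SchurFn (β n)) ∧
      (∀ n, β n ∉ I) ∧ (∀ n, ∀ z ∈ unitDisk, g n z = β n z * g (n + 1) z) ∧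
      ∀ n z, ‖z‖ ≤ rad n → g (n + 1) z ≠ 0 := by
  choose β h h1 h2 h3 h4 h5 using
    fun (n : ℕ) (g : {g : ℂ → ℂ // SchurFn g ∧ g 0 ≠ 0}) => factor hp hI hnd hno n g.2.1 g.2.2
  have hne : ∀ n g, h n g 0 ≠ 0 := fun n g hz => g.2.2 (by
    rw [h4 n g 0 zero_mem_unitDisk, hz, mul_zero])
  let G : ℕ → {g : ℂ → ℂ // SchurFn g ∧ g 0 ≠ 0} :=
    fun n => Nat.rec ⟨b, hb, hb0⟩ (fun n g => ⟨h n g, h2 n g, hne n g⟩) n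
  exact ⟨fun n => (G n).1, fun n => β n (G n), rfl, fun n => (G n).2.1, fun n => h1 n _,
    fun n => h3 n _, fun n => h4 n (G n), fun n => h5 n (G n)⟩

/-- The limit of the remaining factors is zero-free. -/
lemma limit_zero_free {b g : ℂ → ℂ} {G : ℕ → ℂ → ℂ} (hb : DifferentiableOn ℂ b unitDisk)
    (hb0 : b 0 ≠ 0) (hG : ∀ n, SchurFn (G n)) (hle : ∀ n, ∀ z ∈ unitDisk, ‖b z‖ ≤ ‖G n z‖)
    (hz : ∀ n z, ‖z‖ ≤ rad n → G (n + 1) z ≠ 0)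
    (hlim : ∀ z ∈ unitDisk, Tendsto (fun n => G n z) (hyperfilter ℕ : Filter ℕ) (𝓝 (g z)))
    {a : ℂ} (ha : a ∈ unitDisk) : g a ≠ 0 := by
  have hbA := hb.analyticOnNhd isOpen_unitDisk
  have hpre : IsPreconnected unitDisk := (convex_ball (0 : ℂ) 1).isPreconnected
  have h1 : ∀ᶠ z in 𝓝[≠] a, b z ≠ 0 := by
    rcases (hbA a ha).eventually_eq_zero_or_eventually_ne_zero with h | h
    · exact absurd (hbA.eqOn_zero_of_preconnected_of_eventuallyEq_zero hpre ha h
        zero_mem_unitDisk) hb0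
    · exact h
  rw [eventually_nhdsWithin_iff, Metric.eventually_nhds_iff] at h1
  obtain ⟨ε, hε, h1⟩ := h1
  have ha1 := mem_unitDisk.1 ha
  obtain ⟨ρ, hρ0, hρ⟩ : ∃ ρ, 0 < ρ ∧ ρ < min ε (1 - ‖a‖) :=
    exists_between (lt_min hε (by linarith))
  have hρ1 := hρ.trans_le (min_le_left _ _)
  have hρ2 := hρ.trans_le (min_le_right _ _)
  have hsub : ∀ z ∈ Metric.closedBall a ρ, ‖z‖ ≤ ‖a‖ + ρ := by
    intro z hz
    rw [mem_closedBall_iff_norm] at hz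
    have := norm_add_le a (z - a)
    rw [add_sub_cancel] at this
    linarith
  have hsubD : Metric.closedBall a ρ ⊆ unitDisk := fun z hz =>
    mem_unitDisk.2 ((hsub z hz).trans_lt (by linarith))
  obtain ⟨x, hx, hmin⟩ := (isCompact_sphere a ρ).exists_isMinOn
    (NormedSpace.sphere_nonempty.2 hρ0.le)
    (hb.continuousOn.mono (Metric.sphere_subset_closedBall.trans hsubD)).norm
  have hbx : 0 < ‖b x‖ := by
    rw [norm_pos_iff]
    rw [mem_sphere_iff_norm] at hx
    refine h1 (by rw [dist_eq_norm, hx]; exact hρ1) ?_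
    rintro rfl
    simp at hx
    linarith
  have hev : ∀ᶠ n in atTop, ‖b x‖ ≤ ‖G n a‖ := by
    have h2 : ∀ᶠ n in atTop, ‖a‖ + ρ < rad n :=
      rad_tendsto'.eventually (lt_mem_nhds (by linarith))
    have h3 : ∀ᶠ n in atTop, ‖b x‖ ≤ ‖G (n + 1) a‖ := by
      filter_upwards [h2] with n hn
      have hne : ∀ z ∈ Metric.closedBall a ρ, G (n + 1) z ≠ 0 := fun z hzz =>
        hz n z ((hsub z hzz).trans hn.le)
      have hd : DifferentiableOn ℂ (fun z => (G (n + 1) z)⁻¹) (Metric.closedBall a ρ) :=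
        ((hG (n + 1)).1.mono hsubD).inv hne
      have h4 : ‖(G (n + 1) a)⁻¹‖ ≤ ‖b x‖⁻¹ := by
        refine Complex.norm_le_of_forall_mem_frontier_norm_le (U := Metric.ball a ρ)
          Metric.isBounded_ball (f := fun z => (G (n + 1) z)⁻¹)
          (hd.mono Metric.closure_ball_subset_closedBall).diffContOnCl (fun ζ hζ => ?_)
          (subset_closure (Metric.mem_ball_self hρ0))
        rw [frontier_ball _ hρ0.ne'] at hζ
        rw [norm_inv]
        refine inv_anti₀ hbx ((hmin hζ).trans (hle _ _ (hsubD ?_)))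
        exact Metric.sphere_subset_closedBall hζ
      rw [norm_inv] at h4
      exact (inv_le_inv₀ (norm_pos_iff.2 (hne a (Metric.mem_closedBall_self hρ0.le))) hbx).1 h4
    obtain ⟨N, hN⟩ := eventually_atTop.1 h3
    refine eventually_atTop.2 ⟨N + 1, fun n hn => ?_⟩
    obtain ⟨m, rfl⟩ : ∃ m, n = m + 1 := ⟨n - 1, by omega⟩
    exact hN m (by omega)
  have h5 := ge_of_tendsto (hlim a ha).norm (Nat.hyperfilter_le_atTop hev)
  exact norm_pos_iff.1 (hbx.trans_le h5)

lemma exists_log {g : ℂ → ℂ} (hg : DifferentiableOn ℂ g unitDisk) (hz : ∀ z ∈ unitDisk, g z ≠ 0) :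
    ∃ L : ℂ → ℂ, DifferentiableOn ℂ L unitDisk ∧ ∀ z ∈ unitDisk, g z = Complex.exp (L z) := by
  have hd : DifferentiableOn ℂ (fun z => deriv g z / g z) unitDisk :=
    (hg.deriv isOpen_unitDisk).div hg hz
  obtain ⟨L, hL0, hL⟩ := (DifferentiableOn.isExactOn_ball hd).with_val_at 0 (Complex.log (g 0))
  have hgd : ∀ z ∈ unitDisk, HasDerivAt g (deriv g z) z := fun z hz =>
    (hg.differentiableAt (isOpen_unitDisk.mem_nhds hz)).hasDerivAt
  have hquot : ∀ z ∈ unitDisk, HasDerivAt (fun z => g z * Complex.exp (-L z)) 0 z := by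
    intro z hzz
    have h1 := (hgd z hzz).mul (hL z hzz).neg.cexp
    refine h1.congr_deriv ?_
    have := mul_div_cancel₀ (deriv g z) (hz z hzz)
    linear_combination -Complex.exp (-L z) * this
  refine ⟨L, fun z hz => (hL z hz).differentiableAt.differentiableWithinAt, fun z hzz => ?_⟩
  have h2 : g z * Complex.exp (-L z) = g 0 * Complex.exp (-L 0) := by
    refine IsOpen.is_const_of_deriv_eq_zero isOpen_unitDisk
      (convex_ball (0 : ℂ) 1).isPreconnected
      (fun z hz => (hquot z hz).differentiableAt.differentiableWithinAt)
      (fun z hz => (hquot z hz).deriv) hzz zero_mem_unitDisk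
  rw [hL0, Complex.exp_neg, Complex.exp_neg, Complex.exp_log (hz 0 zero_mem_unitDisk),
    mul_inv_cancel₀ (hz 0 zero_mem_unitDisk)] at h2
  exact (mul_inv_eq_one₀ (Complex.exp_ne_zero _)).1 h2

lemma dense_of_zero_free (hp : 1 < p) (hI : IsPrimeIdealInNp p I) (hnd : ¬ IsDenseInNp p I)
    {g : ℂ → ℂ} (hg : SchurFn g) (hgI : g ∈ I) (hz : ∀ z ∈ unitDisk, g z ≠ 0) : False := by
  obtain ⟨L, hLd, hL⟩ := exists_log hg.1 hz
  have hne : ∀ n : ℕ, ((n + 1 : ℕ) : ℂ) ≠ 0 := fun n => Nat.cast_ne_zero.2 n.succ_ne_zero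
  let u : ℕ → ℂ → ℂ := fun n z => Complex.exp (L z / ((n + 1 : ℕ) : ℂ))
  have hpow : ∀ n, ∀ z ∈ unitDisk, u n z ^ (n + 1) = g z := by
    intro n z hz
    simp only [u]
    rw [← Complex.exp_nat_mul, mul_div_cancel₀ _ (hne n), hL z hz]
  have hu : ∀ n, SchurFn (u n) := by
    intro n
    refine ⟨(hLd.div_const _).cexp, fun z hz => ?_⟩
    have h1 := hg.2 z hz
    rw [← hpow n z hz, norm_pow] at h1
    exact (pow_le_one_iff_of_nonneg (norm_nonneg _) n.succ_ne_zero).1 h1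
  refine hnd (dense_of_schur hp hI.1 u (fun n => root_mem hp hI hnd (hu n) hgI (n + 1) (hpow n)) hu ?_)
  have h1 : Tendsto (fun n : ℕ => L 0 / ((n + 1 : ℕ) : ℂ)) atTop (𝓝 0) := by
    have := (tendsto_const_div_atTop_nhds_zero_nat (𝕜 := ℂ) (L 0)).comp (tendsto_add_atTop_nat 1)
    exact this
  have h2 := (Complex.continuous_exp.tendsto _).comp h1
  rw [Complex.exp_zero] at h2
  exact h2

lemma dense_of_modulus (hp : 1 < p) (hI : IsPrimeIdealInNp p I) (hnd : ¬ IsDenseInNp p I)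
    (c : ℕ → ℂ → ℂ) (hc : ∀ n, SchurFn (c n)) (hcI : ∀ n, c n ∈ I) (h0 : ∀ n, c n 0 ≠ 0)
    (hlim : Tendsto (fun n => ‖c n 0‖) atTop (𝓝 1)) : False := by
  have hk : ∀ n, ‖(‖c n 0‖ : ℂ) / c n 0‖ = 1 := by
    intro n
    rw [norm_div, Complex.norm_real, norm_norm, div_self (norm_ne_zero_iff.2 (h0 n))]
  refine hnd (dense_of_schur hp hI.1 (fun n => (fun _ => (‖c n 0‖ : ℂ) / c n 0) * c n) ?_ ?_ ?_)
  · exact fun n => hI.1.mul_mem _ (const_mem_Np hp _) _ (hcI n)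
  · intro n
    exact SchurFn.mul ⟨by fun_prop, fun z _ => (hk n).le⟩ (hc n)
  · have := (Complex.continuous_ofReal.tendsto _).comp hlim
    rw [Complex.ofReal_one] at this
    refine this.congr fun n => ?_
    simp only [Pi.mul_apply, Function.comp_apply]
    rw [div_mul_cancel₀ _ (h0 n)]

lemma exists_linear_mem (hp : 1 < p) (hI : IsPrimeIdealInNp p I) (hnd : ¬ IsDenseInNp p I)
    (hnz : ∃ f ∈ I, ¬ Set.EqOn f 0 unitDisk) : ∃ w ∈ unitDisk, (fun z => z - w) ∈ I := by
  by_contra hcon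
  have hno : ∀ w ∈ unitDisk, (fun z => z - w) ∉ I := fun w hw h => hcon ⟨w, hw, h⟩
  obtain ⟨f, hfI, hf0⟩ := hnz
  obtain ⟨a, ha, hfa⟩ : ∃ a ∈ unitDisk, f a ≠ 0 := by
    by_contra h
    push Not at h
    exact hf0 fun z hz => h z hz
  obtain ⟨G, hG, hGf, hG0⟩ := exists_multiplier hp (hI.1.subset hfI)
  obtain ⟨c, hc, hc0, hGc, hfc⟩ := exists_mul_ne_zero hG.1 (hI.1.subset hfI).1
    zero_mem_unitDisk ha hG0 hfa
  have hGfI : G * f ∈ I := hI.1.mul_mem _ (hG.mem_Np hp) _ hfI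
  obtain ⟨n, hn⟩ := exists_pow_lt_of_lt_one (norm_pos_iff.2 (mul_ne_zero hGc hfc))
    (mem_unitDisk.1 hc)
  obtain ⟨b, hbI, hb, hb0⟩ := exists_ne_zero_at_zero hp hI hnd hno hc hc0 n _ hGfI hGf hn
  obtain ⟨g, β, hg0, hg, hβ, hβI, hfac, hzf⟩ := factor_seq hp hI hnd hno hb hb0
  let P : Finset ℕ → ℂ → ℂ := fun s z => ∏ i ∈ s, β i z
  have hP : ∀ s, SchurFn (P s) := schurFn_prod hβ
  have hbfac : ∀ n, ∀ z ∈ unitDisk, b z = P (Finset.range n) z * g n z := by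
    intro n z hz
    induction n with
    | zero => simp [P, hg0]
    | succ n ih =>
      rw [ih, hfac n z hz]
      simp only [P, Finset.prod_range_succ]
      ring
  obtain ⟨B, hB, hBlim⟩ := ultra_lim (fun n => P (Finset.range n)) fun n => hP _
  obtain ⟨γ, hγ, hγlim⟩ := ultra_lim g hg
  have hbB : ∀ z ∈ unitDisk, b z = B z * γ z := by
    intro z hz
    have h1 := (hBlim z hz).mul (hγlim z hz)
    refine tendsto_nhds_unique (tendsto_const_nhds.congr fun n => hbfac n z hz) h1
  have hγz : ∀ z ∈ unitDisk, γ z ≠ 0 := by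
    intro z hz
    refine limit_zero_free hb.1 hb0 hg (fun n z hz => ?_) hzf hγlim hz
    rw [hbfac n z hz, norm_mul]
    exact mul_le_of_le_one_left (norm_nonneg _) ((hP _).2 z hz)
  rcases prime_congr hp hI hnd hbI (hB.mem_Np hp) (hγ.mem_Np hp) hbB with hBI | hγI
  swap
  · exact dense_of_zero_free hp hI hnd hγ hγI hγz
  choose C hC hClim using fun n => ultra_lim (fun m => P (Finset.Ico n m)) fun m => hP _
  have hBC : ∀ n, ∀ z ∈ unitDisk, B z = P (Finset.range n) z * C n z := by
    intro n z hz
    have h1 := (hClim n z hz).const_mul (P (Finset.range n) z)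
    refine tendsto_nhds_unique_of_eventuallyEq (hBlim z hz) h1 ?_
    refine Nat.hyperfilter_le_atTop ?_
    filter_upwards [eventually_ge_atTop n] with m hm
    simp only [P]
    rw [Finset.prod_range_mul_prod_Ico _ hm]
  have hCI : ∀ n, C n ∈ I := fun n =>
    (prime_congr hp hI hnd hBI ((hP _).mem_Np hp) ((hC n).mem_Np hp) (hBC n)).resolve_left
      (prod_not_mem hp hI hnd hβ hβI _)
  have hB0 : B 0 ≠ 0 := by
    intro h
    apply hb0
    rw [hbB 0 zero_mem_unitDisk, h, zero_mul]
  have hP0 : ∀ n, P (Finset.range n) 0 ≠ 0 := by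
    intro n h
    apply hB0
    rw [hBC n 0 zero_mem_unitDisk, h, zero_mul]
  have hC0 : ∀ n, C n 0 ≠ 0 := by
    intro n h
    apply hB0
    rw [hBC n 0 zero_mem_unitDisk, h, mul_zero]
  refine dense_of_modulus hp hI hnd C hC hCI hC0 ?_
  have hanti : Antitone fun n => ‖P (Finset.range n) 0‖ := by
    refine antitone_nat_of_succ_le fun n => ?_
    simp only [P, Finset.prod_range_succ, norm_mul]
    exact mul_le_of_le_one_right (norm_nonneg _) ((hβ n).2 0 zero_mem_unitDisk)
  have hl1 := tendsto_atTop_ciInf hanti ⟨0, by rintro _ ⟨n, rfl⟩; exact norm_nonneg _⟩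
  have hl2 := tendsto_nhds_unique (hl1.mono_left Nat.hyperfilter_le_atTop)
    (hBlim 0 zero_mem_unitDisk).norm
  rw [hl2] at hl1
  have hl3 := (tendsto_const_nhds (x := ‖B 0‖)).div hl1 (norm_ne_zero_iff.2 hB0)
  rw [div_self (norm_ne_zero_iff.2 hB0)] at hl3
  refine hl3.congr fun n => ?_
  rw [Pi.div_apply, hBC n 0 zero_mem_unitDisk, norm_mul, mul_div_cancel_left₀ _ (norm_ne_zero_iff.2 (hP0 n))]

lemma dslope_mem_Np (hp : 1 < p) {f : ℂ → ℂ} (hf : f ∈ NpClass p) {w : ℂ} (hw : w ∈ unitDisk)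
    (hfw : f w = 0) : dslope f w ∈ NpClass p := by
  have hd : DifferentiableOn ℂ (dslope f w) unitDisk :=
    (Complex.differentiableOn_dslope (isOpen_unitDisk.mem_nhds hw)).2 hf.1
  have hw1 := mem_unitDisk.1 hw
  let δ : ℝ := (1 - ‖w‖) / 2
  have hδ : 0 < δ := by simp only [δ]; linarith
  have hsub : Metric.closedBall w δ ⊆ unitDisk := by
    intro z hz
    rw [mem_closedBall_iff_norm] at hz
    have := norm_add_le w (z - w)
    rw [add_sub_cancel] at this
    rw [mem_unitDisk]
    simp only [δ] at hz
    linarith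
  obtain ⟨K, hK⟩ := (isCompact_closedBall w δ).exists_bound_of_continuousOn
    (hd.continuousOn.mono hsub)
  refine Np_of_le hp hf hd (max K δ⁻¹) fun z hz => ?_
  have hm : 0 ≤ max K δ⁻¹ := le_trans (inv_nonneg.2 hδ.le) (le_max_right _ _)
  by_cases hzb : z ∈ Metric.closedBall w δ
  · refine (hK z hzb).trans ((le_max_left K δ⁻¹).trans ?_)
    refine le_mul_of_one_le_right hm ?_
    simp
  · rw [mem_closedBall_iff_norm, not_le] at hzb
    have hne : z ≠ w := by
      rintro rfl
      simp at hzb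
      linarith
    rw [dslope_of_ne _ hne, slope_def_field, hfw, sub_zero, norm_div, div_eq_inv_mul]
    have h1 : ‖z - w‖⁻¹ ≤ max K δ⁻¹ := (inv_anti₀ hδ hzb.le).trans (le_max_right _ _)
    gcongr
    linarith

end Ideal

/-- A nonzero prime ideal of `N^p` (`1 < p < ∞`) which is not dense in
`(N^p, d_p)` is of the form `{f ∈ N^p : f(λ) = 0}` for some `λ` in the unit disk. -/
theorem prime_ideal_not_dense_eq_vanishing_ideal_Np (p : ℝ) (hp : 1 < p)
    (I : Set (ℂ → ℂ)) (hI : IsPrimeIdealInNp p I)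
    (hnz : ∃ f ∈ I, ¬ Set.EqOn f 0 unitDisk)
    (hnd : ¬ IsDenseInNp p I) :
    ∃ w ∈ unitDisk, I = {f ∈ NpClass p | f w = 0} := by
  obtain ⟨w, hw, hwI⟩ := exists_linear_mem hp hI hnd hnz
  refine ⟨w, hw, ?_⟩
  ext f
  constructor
  · intro hf
    refine ⟨hI.1.subset hf, ?_⟩
    by_contra hfw
    have hfN := hI.1.subset hf
    have hd : DifferentiableOn ℂ (fun z => f z - f w) unitDisk := hfN.1.sub_const _
    have hN : (fun z => f z - f w) ∈ NpClass p := by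
      refine Np_of_le hp hfN hd (1 + ‖f w‖) fun z _ => (norm_sub_le _ _).trans ?_
      nlinarith [norm_nonneg (f z), norm_nonneg (f w)]
    have hdN := dslope_mem_Np hp hN hw (sub_self _)
    have h1 : (fun z => f z - f w) ∈ I := by
      refine mem_congr hp hI hnd (hI.1.mul_mem _ hdN _ hwI) fun z _ => ?_
      have := sub_smul_dslope (fun z => f z - f w) w z
      simp only [smul_eq_mul, sub_self, sub_zero] at this
      rw [Pi.mul_apply, ← this, mul_comm]
    have h2 := hI.1.add_mem _ hf _ (hI.1.neg_mem _ h1)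
    have h3 := hI.1.mul_mem _ (const_mem_Np hp (f w)⁻¹) _ h2
    refine one_not_mem hp hI hnd ?_ h3
    intro z _
    simp [hfw]
  · rintro ⟨hfN, hfw⟩
    have hdN := dslope_mem_Np hp hfN hw hfw
    refine mem_congr hp hI hnd (hI.1.mul_mem _ hdN _ hwI) fun z _ => ?_
    have := sub_smul_dslope f w z
    rw [hfw, sub_zero, smul_eq_mul] at this
    rw [Pi.mul_apply, ← this, mul_comm]
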